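/- arXiv:2107.02131 — 10 statements merged into one kernel-verified Lean document; each statement's English description precedes it below -/
import Mathlib

section
/- Let F_q be a finite field, let Γ ⊆ F_q[x]^2 be an F_q[x]-lattice of rank 2 with volume vol(Γ) = q^m, and let r ≥ 0 be a nonnegative integer. Then the number of vectors v ∈ Γ that are primitive in Γ and satisfy deg v ≤ r is at most max(q, q^{2r−m+2}). -/
open Polynomial

/-- all coordinates have degree `< a` -/
def DegLt {F : Type*} [Field F] (a : ℕ) (w : Fin 2 → F[X]) : Prop :=
  ∀ i, ∀ n, a ≤ n → (w i).coeff n = 0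

noncomputable def det2 {F : Type*} [Field F] (u v : Fin 2 → F[X]) : F[X] := u 0 * v 1 - u 1 * v 0

def Good {F : Type*} [Field F] (r : ℕ) (Γ : Submodule F[X] (Fin 2 → F[X])) : Prop :=
  ∃ (a b : ℕ) (u v : Fin 2 → F[X]), a ≤ r ∧ b ≤ r ∧ u ∈ Γ ∧ v ∈ Γ ∧ DegLt (a+1) u ∧
    DegLt (b+1) v ∧ (u 0).coeff a * (v 1).coeff b - (u 1).coeff a * (v 0).coeff b ≠ 0

theorem coeff_shift {F : Type*} [Field F] (c : F) (k a n : ℕ) (h : n = a + k) (p : F[X]) :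
    (C c * X ^ k * p).coeff n = c * p.coeff a := by
  subst h
  rw [mul_assoc, coeff_C_mul, coeff_X_pow_mul]

theorem degLt_pred {F : Type*} [Field F] (a : ℕ) (w : Fin 2 → F[X]) (h : DegLt (a+1) w)
    (h0 : ∀ i, (w i).coeff a = 0) : DegLt a w := by
  intro i n hn
  rcases Nat.eq_or_lt_of_le hn with h1 | h1
  · subst h1; exact h0 i
  · exact h i n h1

theorem degLt_shift {F : Type*} [Field F] (c : F) (k a : ℕ) (w : Fin 2 → F[X])
    (h : DegLt a w) : DegLt (a + k) ((C c * X ^ k) • w) := by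
  intro i n hn
  obtain ⟨t, rfl⟩ := Nat.exists_eq_add_of_le hn
  have := coeff_shift c k (a + t) (a + k + t) (by ring) (w i)
  rw [Pi.smul_apply, smul_eq_mul, this, h i _ (by omega), mul_zero]

theorem degLt_sub {F : Type*} [Field F] (a : ℕ) (u w : Fin 2 → F[X])
    (h : DegLt a u) (h' : DegLt a w) : DegLt a (u - w) := by
  intro i n hn
  rw [Pi.sub_apply, coeff_sub, h i n hn, h' i n hn, sub_zero]

theorem good_of {F : Type*} [Field F] (r : ℕ) (Γ : Submodule F[X] (Fin 2 → F[X])) (s : ℕ) :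
    ∀ (a b : ℕ) (u v : Fin 2 → F[X]), a + b = s → a ≤ b → a ≤ r + 1 → b ≤ r + 1 → u ∈ Γ → v ∈ Γ →
      DegLt a u → DegLt b v → det2 u v ≠ 0 → Good r Γ := by
  induction s using Nat.strong_induction_on with
  | _ s ih =>
  have ih' : ∀ (a b : ℕ) (u v : Fin 2 → F[X]), a + b < s → a ≤ r + 1 → b ≤ r + 1 →
      u ∈ Γ → v ∈ Γ → DegLt a u → DegLt b v → det2 u v ≠ 0 → Good r Γ := by
    intro a b u v hs ha hb hu hv hau hbv hd
    rcases le_total a b with h | h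
    · exact ih _ hs a b u v rfl h ha hb hu hv hau hbv hd
    · refine ih _ hs b a v u (by ring) h hb ha hv hu hbv hau ?_
      intro h0
      apply hd
      unfold det2 at *
      linear_combination -h0
  intro a b u v hs hab ha hb hu hv hau hbv hd
  rcases a with _ | a
  · exfalso; apply hd
    have hz : ∀ i, u i = 0 := fun i => by ext n; simpa using hau i n (Nat.zero_le _)
    simp [det2, hz]
  rcases b with _ | b
  · omega
  by_cases hl : (u 0).coeff a * (v 1).coeff b - (u 1).coeff a * (v 0).coeff b = 0
  swap
  · exact ⟨a, b, u, v, by omega, by omega, hu, hv, hau, hbv, hl⟩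
  by_cases hz : ∀ i, (u i).coeff a = 0
  · exact ih' a (b+1) u v (by omega) (by omega) hb hu hv (degLt_pred a u hau hz) hbv hd
  push Not at hz
  obtain ⟨i, hi⟩ := hz
  set c := (v i).coeff b / (u i).coeff a with hc
  have hcm : c * (u i).coeff a = (v i).coeff b := by rw [hc]; field_simp
  refine ih' (a+1) b u (v - (C c * X ^ (b - a)) • u) (by omega) ha (by omega) hu
    (Γ.sub_mem hv (Γ.smul_mem _ hu)) hau ?_ ?_
  · apply degLt_pred
    · apply degLt_sub _ _ _ hbv
      have := degLt_shift c (b - a) (a+1) u hau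
      rwa [show a + 1 + (b - a) = b + 1 by omega] at this
    · intro j
      rw [Pi.sub_apply, coeff_sub, Pi.smul_apply, smul_eq_mul,
        coeff_shift c (b-a) a b (by omega)]
      apply mul_left_cancel₀ hi
      have : (u i).coeff a * (v j).coeff b = (u j).coeff a * (v i).coeff b := by
        fin_cases i <;> fin_cases j <;> simp only [Fin.zero_eta, Fin.mk_one, Fin.isValue] <;>
          first | ring1 | linear_combination hl | linear_combination -hl
      linear_combination this - (u j).coeff a * hcm
  · intro h0
    apply hd
    simp only [det2, Pi.sub_apply, Pi.smul_apply, smul_eq_mul] at h0 ⊢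
    linear_combination h0

theorem good_surj {F : Type*} [Field F] (r : ℕ) (Γ : Submodule F[X] (Fin 2 → F[X]))
    (hg : Good r Γ) (n : ℕ) : ∀ w : Fin 2 → F[X], DegLt (r + 1 + n) w →
      ∃ w', DegLt (r+1) w' ∧ w - w' ∈ Γ := by
  obtain ⟨a, b, u, v, ha, hb, hu, hv, hau, hbv, hl⟩ := hg
  induction n with
  | zero => intro w hw; exact ⟨w, hw, by simp⟩
  | succ n ih =>
    intro w hw
    set N := r + 1 + n with hN
    set D := (u 0).coeff a * (v 1).coeff b - (u 1).coeff a * (v 0).coeff b with hD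
    set c := ((w 0).coeff N * (v 1).coeff b - (w 1).coeff N * (v 0).coeff b) / D with hc
    set d := ((u 0).coeff a * (w 1).coeff N - (u 1).coeff a * (w 0).coeff N) / D with hd
    have hc' : c * D = ((w 0).coeff N * (v 1).coeff b - (w 1).coeff N * (v 0).coeff b) := by
      rw [hc]; field_simp
    have hd' : d * D = ((u 0).coeff a * (w 1).coeff N - (u 1).coeff a * (w 0).coeff N) := by
      rw [hd]; field_simp
    obtain ⟨w', h1, h2⟩ := ih (w - (C c * X ^ (N - a)) • u - (C d * X ^ (N - b)) • v) (by
      apply degLt_pred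
      · apply degLt_sub
        · apply degLt_sub _ _ _ hw
          have := degLt_shift c (N - a) (a+1) u hau
          rwa [show a + 1 + (N - a) = N + 1 by omega] at this
        · have := degLt_shift d (N - b) (b+1) v hbv
          rwa [show b + 1 + (N - b) = N + 1 by omega] at this
      · intro j
        rw [Pi.sub_apply, Pi.sub_apply, coeff_sub, coeff_sub, Pi.smul_apply, smul_eq_mul,
          Pi.smul_apply, smul_eq_mul,
          coeff_shift c (N-a) a N (by omega), coeff_shift d (N-b) b N (by omega)]
        apply mul_left_cancel₀ hl
        fin_cases j <;> simp only [Fin.zero_eta, Fin.mk_one, Fin.isValue]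
        · linear_combination (w 0).coeff N * hD - (u 0).coeff a * hc' - (v 0).coeff b * hd'
        · linear_combination (w 1).coeff N * hD - (u 1).coeff a * hc' - (v 1).coeff b * hd')
    refine ⟨w', h1, ?_⟩
    have := Γ.add_mem (Γ.add_mem h2 (Γ.smul_mem (C c * X ^ (N - a)) hu))
      (Γ.smul_mem (C d * X ^ (N - b)) hv)
    convert this using 1
    abel

theorem exists_degLt {F : Type*} [Field F] (w : Fin 2 → F[X]) (r : ℕ) :
    ∃ n, DegLt (r + 1 + n) w := by
  refine ⟨(w 0).natDegree + (w 1).natDegree, fun i n hn => ?_⟩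
  apply coeff_eq_zero_of_natDegree_lt
  fin_cases i <;> simp <;> omega

theorem degLt_iff {F : Type*} [Field F] (w : Fin 2 → F[X]) (a : ℕ) :
    DegLt a w ↔ ∀ i, w i ∈ degreeLT F a := by
  simp only [DegLt, mem_degreeLT, degree_lt_iff_coeff_zero]

theorem card_good {F : Type*} [Field F] [Fintype F] (m r : ℕ)
    (Γ : Submodule F[X] (Fin 2 → F[X]))
    (hvol : Nat.card ((Fin 2 → F[X]) ⧸ Γ) = Fintype.card F ^ m) (hg : Good r Γ) :
    ∃ K : Set (Fin 2 → F[X]), K.Finite ∧ (∀ w ∈ Γ, DegLt (r+1) w → w ∈ K) ∧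
      K.ncard * Fintype.card F ^ m = Fintype.card F ^ (2 * r + 2) := by
  let f : (Fin 2 → degreeLT F (r+1)) →+ ((Fin 2 → F[X]) ⧸ Γ) :=
    { toFun := fun w => Γ.mkQ (fun i => (w i : F[X]))
      map_zero' := by
        exact map_zero Γ.mkQ
      map_add' := fun x y => by
        exact map_add Γ.mkQ _ _ }
  have hf : Function.Surjective f := by
    intro q
    obtain ⟨w, rfl⟩ := Γ.mkQ_surjective q
    obtain ⟨n, hn⟩ := exists_degLt w r
    obtain ⟨w', h1, h2⟩ := good_surj r Γ hg n w hn
    rw [degLt_iff] at h1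
    refine ⟨fun i => ⟨w' i, h1 i⟩, ?_⟩
    change Γ.mkQ w' = Γ.mkQ w
    exact ((Submodule.Quotient.eq Γ).2 h2).symm
  have : Finite (degreeLT F (r+1)) := Finite.of_equiv _ (degreeLTEquiv F (r+1)).symm.toEquiv
  have hcard : Nat.card (Fin 2 → degreeLT F (r+1)) = Fintype.card F ^ (2 * r + 2) := by
    rw [Nat.card_fun, Nat.card_congr (degreeLTEquiv F (r+1)).toEquiv, Nat.card_fun]
    simp only [Nat.card_eq_fintype_card, Fintype.card_fin]
    rw [← pow_mul]; congr 1; ring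
  have h1 := AddSubgroup.card_eq_card_quotient_mul_card_addSubgroup f.ker
  rw [Nat.card_congr (QuotientAddGroup.quotientKerEquivOfSurjective f hf).toEquiv, hvol,
    hcard] at h1
  have hinj : Function.Injective (fun (w : Fin 2 → degreeLT F (r+1)) (i : Fin 2) => (w i : F[X])) := by
    intro x y h
    funext i
    exact Subtype.ext (congrFun h i)
  refine ⟨Set.image (fun (w : Fin 2 → degreeLT F (r+1)) (i : Fin 2) => (w i : F[X])) (f.ker : Set _),
    Set.toFinite _, ?_, ?_⟩
  · intro w hw hd
    rw [degLt_iff] at hd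
    refine ⟨fun i => ⟨w i, hd i⟩, ?_, rfl⟩
    change Γ.mkQ w = 0
    simpa using hw
  · rw [Set.ncard_image_of_injective _ hinj, h1, mul_comm]
    rfl

theorem prim_prop {F : Type*} [Field F] (Γ : Submodule F[X] (Fin 2 → F[X]))
    (u v : Fin 2 → F[X]) (hu : u ∈ Γ) (hv : v ∈ Γ)
    (pu : ¬ ∃ (a : F[X]) (w : Fin 2 → F[X]), w ∈ Γ ∧ 1 ≤ a.degree ∧ u = a • w)
    (pv : ¬ ∃ (a : F[X]) (w : Fin 2 → F[X]), w ∈ Γ ∧ 1 ≤ a.degree ∧ v = a • w)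
    (hd : det2 u v = 0) : ∃ c : F, v = C c • u := by
  have hu0 : u ≠ 0 := by
    rintro rfl
    exact pu ⟨X, 0, Γ.zero_mem, by simp, by simp⟩
  obtain ⟨i, hi⟩ : ∃ i, u i ≠ 0 := by
    by_contra! h
    exact hu0 (funext h)
  have hrel : ∀ j, v i * u j = u i * v j := by
    unfold det2 at hd
    intro j
    fin_cases i <;> fin_cases j <;> simp only [Fin.zero_eta, Fin.mk_one, Fin.isValue] <;>
      first | ring1 | linear_combination hd | linear_combination -hd
  classical
  obtain ⟨g, a, b, hg, hab, ha, hb⟩ : ∃ g a b : F[X], g ≠ 0 ∧ IsCoprime a b ∧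
      v i = g * a ∧ u i = g * b := by
    have hg0 : EuclideanDomain.gcd (v i) (u i) ≠ 0 := fun h =>
      hi (EuclideanDomain.gcd_eq_zero_iff.1 h).2
    obtain ⟨a, ha⟩ := EuclideanDomain.gcd_dvd_left (v i) (u i)
    obtain ⟨b, hb⟩ := EuclideanDomain.gcd_dvd_right (v i) (u i)
    refine ⟨_, a, b, hg0, ?_, ha, hb⟩
    refine ⟨EuclideanDomain.gcdA (v i) (u i), EuclideanDomain.gcdB (v i) (u i), ?_⟩
    apply mul_left_cancel₀ hg0
    have := EuclideanDomain.gcd_eq_gcd_ab (v i) (u i)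
    linear_combination -this - EuclideanDomain.gcdA (v i) (u i) * ha - EuclideanDomain.gcdB (v i) (u i) * hb
  have hrel' : ∀ j, a * u j = b * v j := by
    intro j
    apply mul_left_cancel₀ hg
    linear_combination hrel j - u j * ha + v j * hb
  obtain ⟨s, t, hst⟩ := hab
  have hw : t • u + s • v ∈ Γ := Γ.add_mem (Γ.smul_mem _ hu) (Γ.smul_mem _ hv)
  have e1 : u = b • (t • u + s • v) := by
    funext j
    simp only [Pi.smul_apply, Pi.add_apply, smul_eq_mul]
    linear_combination s * hrel' j - u j * hst
  have e2 : v = a • (t • u + s • v) := by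
    funext j
    simp only [Pi.smul_apply, Pi.add_apply, smul_eq_mul]
    linear_combination -t * hrel' j - v j * hst
  have key : ∀ p : F[X], ¬ 1 ≤ p.degree → ∃ c, p = C c := by
    intro p hp
    refine ⟨p.coeff 0, eq_C_of_degree_le_zero ?_⟩
    by_contra h
    apply hp
    rw [not_le] at h
    exact Nat.WithBot.one_le_iff_zero_lt.2 h
  obtain ⟨b0, rfl⟩ := key b (fun h => pu ⟨b, _, hw, h, e1⟩)
  obtain ⟨a0, rfl⟩ := key a (fun h => pv ⟨a, _, hw, h, e2⟩)
  have hb0 : b0 ≠ 0 := by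
    rintro rfl
    apply hi; rw [hb]; simp
  refine ⟨a0 / b0, ?_⟩
  funext j
  apply mul_left_cancel₀ (C_ne_zero.2 hb0)
  rw [← hrel' j, Pi.smul_apply, smul_eq_mul, ← mul_assoc, ← C_mul, mul_div_cancel₀ _ hb0]



/-- Let `Γ ⊆ F_q[x]^2` be an `F_q[x]`-lattice of rank 2 with volume `q^m` and `r ≥ 0`.
The number of primitive vectors `v ∈ Γ` with `deg v ≤ r` is at most `max(q, q^{2r-m+2})`.
A vector `v` is primitive in `Γ` if it cannot be written `v = a • w` with `w ∈ Γ` and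
`deg a ≥ 1`. -/
theorem stmt_1 (Fq : Type*) [Field Fq] [Fintype Fq] (m r : ℕ)
    (Γ : Submodule (Polynomial Fq) (Fin 2 → Polynomial Fq))
    (hvol : Nat.card ((Fin 2 → Polynomial Fq) ⧸ Γ) = Fintype.card Fq ^ m) :
    (Nat.card {v : Fin 2 → Polynomial Fq //
        v ∈ Γ ∧
        (¬ ∃ (a : Polynomial Fq) (w : Fin 2 → Polynomial Fq),
            w ∈ Γ ∧ 1 ≤ a.degree ∧ v = a • w) ∧
        ∀ i, (v i).degree ≤ (r : WithBot ℕ)} : ℝ) ≤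
      max (Fintype.card Fq : ℝ) ((Fintype.card Fq : ℝ) ^ (2 * (r : ℤ) - (m : ℤ) + 2)) := by
  have hq : 0 < (Fintype.card Fq : ℝ) := by exact_mod_cast Fintype.card_pos
  have hdeg : ∀ v : Fin 2 → Fq[X], (∀ i, (v i).degree ≤ (r : WithBot ℕ)) → DegLt (r+1) v := by
    intro v hv i n hn
    exact coeff_eq_zero_of_degree_lt (lt_of_le_of_lt (hv i) (by exact_mod_cast hn))
  set P : Set (Fin 2 → Fq[X]) := {v | v ∈ Γ ∧
        (¬ ∃ (a : Polynomial Fq) (w : Fin 2 → Polynomial Fq),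
            w ∈ Γ ∧ 1 ≤ a.degree ∧ v = a • w) ∧
        ∀ i, (v i).degree ≤ (r : WithBot ℕ)} with hP
  change ((P.ncard : ℕ) : ℝ) ≤ _
  by_cases hg : Good r Γ
  · apply le_max_of_le_right
    obtain ⟨K, hK, hsub, hcard⟩ := card_good m r Γ hvol hg
    have h1 : P.ncard ≤ K.ncard :=
      Set.ncard_le_ncard (fun v hv => hsub v hv.1 (hdeg v hv.2.2)) hK
    have h2 : (K.ncard : ℝ) * (Fintype.card Fq : ℝ) ^ m = (Fintype.card Fq : ℝ) ^ (2 * r + 2) := by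
      exact_mod_cast hcard
    have h3 : (Fintype.card Fq : ℝ) ^ (2 * (r : ℤ) - (m : ℤ) + 2) = K.ncard := by
      rw [show 2 * (r : ℤ) - (m : ℤ) + 2 = ((2 * r + 2 : ℕ) : ℤ) - (m : ℤ) by push_cast; ring,
        zpow_sub₀ hq.ne', zpow_natCast, zpow_natCast, ← h2]
      field_simp
    rw [h3]
    exact_mod_cast h1
  · apply le_max_of_le_left
    rcases P.eq_empty_or_nonempty with h0 | ⟨u, hu⟩
    · rw [h0]; simp
    have hsub : P ⊆ Set.range (fun c : Fq => C c • u) := by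
      intro v hv
      obtain ⟨c, hc⟩ := prim_prop Γ u v hu.1 hv.1 hu.2.1 hv.2.1 (by
        by_contra hd
        exact hg (good_of r Γ _ (r+1) (r+1) u v rfl le_rfl le_rfl le_rfl hu.1 hv.1
          (hdeg u hu.2.2) (hdeg v hv.2.2) hd))
      exact ⟨c, hc.symm⟩
    have h1 := Set.ncard_le_ncard hsub (Set.toFinite _)
    have h2 : (Set.range (fun c : Fq => C c • u)).ncard ≤ Fintype.card Fq := by
      rw [← Set.image_univ]
      refine (Set.ncard_image_le (Set.toFinite _)).trans ?_
      rw [Set.ncard_univ, Nat.card_eq_fintype_card]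
    exact_mod_cast h1.trans h2
end

section
/- Let F_q be a finite field, let Γ ⊆ F_q[x]^2 be an F_q[x]-lattice of rank 2 with volume vol(Γ) = q^m, and let r, s ≥ 0 be nonnegative integers. Then the number of vectors v = (g, h) ∈ Γ (with g, h ∈ F_q[x]) that are primitive in Γ and satisfy deg g ≤ r and deg h ≤ s is at most max(q, q^{r+s−m+2}). -/
open Polynomial

lemma stmt_2_collinear (Fq : Type*) [Field Fq]
    (Γ : Submodule (Polynomial Fq) (Fin 2 → Polynomial Fq))
    (v w : Fin 2 → Polynomial Fq) (hv : v ∈ Γ) (hw : w ∈ Γ)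
    (pv : ¬ ∃ (a : Polynomial Fq) (u : Fin 2 → Polynomial Fq), u ∈ Γ ∧ 1 ≤ a.degree ∧ v = a • u)
    (pw : ¬ ∃ (a : Polynomial Fq) (u : Fin 2 → Polynomial Fq), u ∈ Γ ∧ 1 ≤ a.degree ∧ w = a • u)
    (hd : v 0 * w 1 - w 0 * v 1 = 0) : ∃ c : Fq, w = (C c : Polynomial Fq) • v := by
  classical
  have hv0 : v ≠ 0 := by
    rintro rfl
    exact pv ⟨X, 0, Γ.zero_mem, by simp, by simp⟩
  obtain ⟨i, hi⟩ : ∃ i, v i ≠ 0 := by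
    by_contra! h
    exact hv0 (funext h)
  have hij : ∀ j, v i * w j = w i * v j := by
    intro j
    fin_cases i <;> fin_cases j <;> simp only [Fin.zero_eta, Fin.mk_one, Fin.isValue] <;>
      first | linear_combination hd | linear_combination -hd | ring
  obtain ⟨g, b, a, hgb, hga, hba, hg0⟩ : ∃ g b a : Polynomial Fq,
      v i = g * b ∧ w i = g * a ∧ IsCoprime b a ∧ g ≠ 0 := by
    have hg0 : EuclideanDomain.gcd (v i) (w i) ≠ 0 :=
      fun h => hi (EuclideanDomain.gcd_eq_zero_iff.1 h).1
    obtain ⟨b, hb⟩ := EuclideanDomain.gcd_dvd_left (v i) (w i)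
    obtain ⟨a, ha⟩ := EuclideanDomain.gcd_dvd_right (v i) (w i)
    have hbez := EuclideanDomain.gcd_eq_gcd_ab (v i) (w i)
    refine ⟨EuclideanDomain.gcd (v i) (w i), b, a, hb, ha,
      ⟨EuclideanDomain.gcdA (v i) (w i), EuclideanDomain.gcdB (v i) (w i), ?_⟩, hg0⟩
    apply mul_left_cancel₀ hg0
    linear_combination -hbez - EuclideanDomain.gcdA (v i) (w i) * hb -
      EuclideanDomain.gcdB (v i) (w i) * ha
  have hb0 : b ≠ 0 := by
    rintro rfl
    simp at hgb
    exact hi hgb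
  have hab : ∀ j, b * w j = a * v j := by
    intro j
    apply mul_left_cancel₀ hg0
    rw [← mul_assoc, ← mul_assoc, ← hgb, ← hga, hij]
  have hdv : ∀ j, b ∣ v j := fun j => hba.dvd_of_dvd_mul_left ⟨w j, (hab j).symm⟩
  choose u hu using hdv
  have hvu : v = b • u := by
    funext j
    simpa using hu j
  have hwu : w = a • u := by
    funext j
    apply mul_left_cancel₀ hb0
    simp only [Pi.smul_apply, smul_eq_mul]
    rw [hab, hu]
    ring
  obtain ⟨x, y, hxy⟩ := hba
  have huΓ : u ∈ Γ := by
    have : u = x • v + y • w := by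
      rw [hvu, hwu, smul_smul, smul_smul, ← add_smul, hxy, one_smul]
    rw [this]
    exact Γ.add_mem (Γ.smul_mem _ hv) (Γ.smul_mem _ hw)
  have key : ∀ p : Polynomial Fq, ¬ (1 ≤ p.degree) → ∃ c, p = C c := by
    intro p hp
    refine ⟨p.coeff 0, eq_C_of_degree_le_zero ?_⟩
    by_contra h
    apply hp
    rw [not_le] at h
    have h2 : 1 ≤ p.natDegree := natDegree_pos_iff_degree_pos.2 h
    have hp0 : p ≠ 0 := by
      rintro rfl
      simp at h
    rw [degree_eq_natDegree hp0]
    exact_mod_cast h2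
  obtain ⟨c, rfl⟩ := key b (fun h => pv ⟨b, u, huΓ, h, hvu⟩)
  obtain ⟨d, rfl⟩ := key a (fun h => pw ⟨a, u, huΓ, h, hwu⟩)
  have hc : c ≠ 0 := by
    rintro rfl
    simp at hb0
  refine ⟨d / c, ?_⟩
  rw [hvu, hwu, smul_smul, ← C_mul, div_mul_cancel₀ _ hc]

lemma stmt_2_reduce (Fq : Type*) [Field Fq] (r s : ℕ)
    (v w z : Fin 2 → Polynomial Fq)
    (hv0 : (v 0).degree ≤ (r : WithBot ℕ)) (hv1 : (v 1).degree ≤ (s : WithBot ℕ))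
    (hw0 : (w 0).degree ≤ (r : WithBot ℕ)) (hw1 : (w 1).degree ≤ (s : WithBot ℕ))
    (hd : v 0 * w 1 - w 0 * v 1 ≠ 0) :
    ∃ p q : Polynomial Fq, (z 0 - p * v 0 - q * w 0).degree < (r + 1 : ℕ) ∧
      (z 1 - p * v 1 - q * w 1).degree < (s + 1 : ℕ) := by
  set D := v 0 * w 1 - w 0 * v 1 with hD
  set A := z 0 * w 1 - z 1 * w 0 with hA
  set B := v 0 * z 1 - v 1 * z 0 with hB
  have key : ∀ (n : ℕ) (t x y : Polynomial Fq), x.degree ≤ (n : WithBot ℕ) →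
      y.degree ≤ (n : WithBot ℕ) → D * t = (A % D) * x + (B % D) * y → t.degree < (n + 1 : ℕ) := by
    intro n t x y hx hy h
    by_contra! hc
    have ht : t ≠ 0 := by
      rintro rfl
      simp at hc
    have hn : n + 1 ≤ t.natDegree := by
      rw [degree_eq_natDegree ht] at hc
      exact_mod_cast hc
    have aux : ∀ P x : Polynomial Fq, x.degree ≤ (n : WithBot ℕ) →
        ((P % D) * x).degree < (D * t).degree := by
      intro P x hx
      have h1 := EuclideanDomain.mod_lt P hd
      have h1 : (P % D).degree < D.degree := h1
      by_cases hz : (P % D) * x = 0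
      · rw [hz, degree_zero, bot_lt_iff_ne_bot, Ne, degree_eq_bot]
        exact mul_ne_zero hd ht
      have hp := left_ne_zero_of_mul hz
      have hx0 := right_ne_zero_of_mul hz
      rw [degree_eq_natDegree hp, degree_eq_natDegree hd] at h1
      rw [degree_eq_natDegree hx0] at hx
      have h1 : (P % D).natDegree < D.natDegree := by exact_mod_cast h1
      have hx : x.natDegree ≤ n := by exact_mod_cast hx
      rw [degree_mul, degree_mul, degree_eq_natDegree hp, degree_eq_natDegree hd,
        degree_eq_natDegree hx0, degree_eq_natDegree ht]
      norm_cast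
      omega
    have := (degree_add_le ((A % D) * x) ((B % D) * y)).trans_lt
      (max_lt (aux A x hx) (aux B y hy))
    rw [h] at this
    exact lt_irrefl _ this
  have eA := EuclideanDomain.div_add_mod A D
  have eB := EuclideanDomain.div_add_mod B D
  refine ⟨A / D, B / D, key r _ _ _ hv0 hw0 ?_, key s _ _ _ hv1 hw1 ?_⟩
  · have e1 : D * z 0 = A * v 0 + B * w 0 := by rw [hD, hA, hB]; ring
    linear_combination e1 - v 0 * eA - w 0 * eB
  · have e1 : D * z 1 = A * v 1 + B * w 1 := by rw [hD, hA, hB]; ring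
    linear_combination e1 - v 1 * eA - w 1 * eB

/-- Let `Γ ⊆ F_q[x]^2` be an `F_q[x]`-lattice of rank 2 with volume `q^m` and `r, s ≥ 0`.
The number of primitive vectors `v = (g, h) ∈ Γ` with `deg g ≤ r` and `deg h ≤ s` is at most
`max(q, q^{r+s-m+2})`. A vector `v` is primitive in `Γ` if it cannot be written `v = a • w`
with `w ∈ Γ` and `deg a ≥ 1`. -/
theorem stmt_2 (Fq : Type*) [Field Fq] [Fintype Fq] (m r s : ℕ)
    (Γ : Submodule (Polynomial Fq) (Fin 2 → Polynomial Fq))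
    (hvol : Nat.card ((Fin 2 → Polynomial Fq) ⧸ Γ) = Fintype.card Fq ^ m) :
    (Nat.card {v : Fin 2 → Polynomial Fq //
        v ∈ Γ ∧
        (¬ ∃ (a : Polynomial Fq) (w : Fin 2 → Polynomial Fq),
            w ∈ Γ ∧ 1 ≤ a.degree ∧ v = a • w) ∧
        (v 0).degree ≤ (r : WithBot ℕ) ∧ (v 1).degree ≤ (s : WithBot ℕ)} : ℝ) ≤
      max (Fintype.card Fq : ℝ)
        ((Fintype.card Fq : ℝ) ^ ((r : ℤ) + (s : ℤ) - (m : ℤ) + 2)) := by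
  classical
  by_cases H : ∃ v w : Fin 2 → Polynomial Fq, v ∈ Γ ∧ w ∈ Γ ∧
      (v 0).degree ≤ (r : WithBot ℕ) ∧ (v 1).degree ≤ (s : WithBot ℕ) ∧
      (w 0).degree ≤ (r : WithBot ℕ) ∧ (w 1).degree ≤ (s : WithBot ℕ) ∧
      v 0 * w 1 - w 0 * v 1 ≠ 0
  · refine le_trans ?_ (le_max_right _ _)
    obtain ⟨v, w, hv, hw, hv0, hv1, hw0, hw1, hd⟩ := H
    let ι : (degreeLT Fq (r + 1) × degreeLT Fq (s + 1)) →+ (Fin 2 → Polynomial Fq) :=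
      { toFun := fun b => ![b.1.1, b.2.1]
        map_zero' := by ext i; fin_cases i <;> simp
        map_add' := by intro x y; ext i; fin_cases i <;> simp }
    let f : (degreeLT Fq (r + 1) × degreeLT Fq (s + 1)) →+ ((Fin 2 → Polynomial Fq) ⧸ Γ) :=
      (Γ.mkQ.toAddMonoidHom).comp ι
    have hf : Function.Surjective f := by
      intro y
      obtain ⟨z, rfl⟩ := Γ.mkQ_surjective y
      obtain ⟨p, q, h0, h1⟩ := stmt_2_reduce Fq r s v w z hv0 hv1 hw0 hw1 hd
      refine ⟨⟨⟨_, mem_degreeLT.2 h0⟩, ⟨_, mem_degreeLT.2 h1⟩⟩, ?_⟩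
      change Γ.mkQ _ = Γ.mkQ z
      rw [← sub_eq_zero, ← map_sub, Submodule.mkQ_apply, Submodule.Quotient.mk_eq_zero]
      have : ι ⟨⟨_, mem_degreeLT.2 h0⟩, ⟨_, mem_degreeLT.2 h1⟩⟩ - z = -(p • v + q • w) := by
        ext1 i
        fin_cases i <;> simp [ι] <;> ring
      rw [this]
      exact Γ.neg_mem (Γ.add_mem (Γ.smul_mem _ hv) (Γ.smul_mem _ hw))
    have cardLT : ∀ n, Nat.card (degreeLT Fq n) = Fintype.card Fq ^ n := by
      intro n
      rw [Nat.card_congr (degreeLTEquiv Fq n).toEquiv]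
      simp
    have hfin : ∀ n, Finite (degreeLT Fq n) := fun n =>
      Finite.of_equiv _ (degreeLTEquiv Fq n).toEquiv.symm
    have := hfin (r + 1)
    have := hfin (s + 1)
    have hcard : Nat.card f.ker * Fintype.card Fq ^ m = Fintype.card Fq ^ (r + s + 2) := by
      have h1 := f.ker.card_mul_index
      rw [AddSubgroup.index_ker, AddMonoidHom.range_eq_top.2 hf, AddSubgroup.card_top, hvol,
        Nat.card_prod, cardLT, cardLT] at h1
      rw [h1]
      ring
    have hle : Nat.card {v : Fin 2 → Polynomial Fq //
        v ∈ Γ ∧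
        (¬ ∃ (a : Polynomial Fq) (w : Fin 2 → Polynomial Fq),
            w ∈ Γ ∧ 1 ≤ a.degree ∧ v = a • w) ∧
        (v 0).degree ≤ (r : WithBot ℕ) ∧ (v 1).degree ≤ (s : WithBot ℕ)} ≤ Nat.card f.ker := by
      have hlt : ∀ (n : ℕ) (p : Polynomial Fq), p.degree ≤ (n : WithBot ℕ) →
          p ∈ degreeLT Fq (n + 1) := fun n p hp => mem_degreeLT.2
            (hp.trans_lt (by exact_mod_cast Nat.lt_succ_self n))
      refine Nat.card_le_card_of_injective
        (fun x => ⟨⟨⟨x.1 0, hlt _ _ x.2.2.2.1⟩, ⟨x.1 1, hlt _ _ x.2.2.2.2⟩⟩, ?_⟩) ?_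
      · rw [AddMonoidHom.mem_ker]
        change Γ.mkQ _ = 0
        rw [Submodule.mkQ_apply, Submodule.Quotient.mk_eq_zero]
        convert x.2.1 using 1
        ext1 i
        fin_cases i <;> simp [ι]
      · intro x y hxy
        simp only [Subtype.mk.injEq, Prod.mk.injEq] at hxy
        apply Subtype.ext
        ext1 i
        fin_cases i
        · exact hxy.1
        · exact hxy.2
    have hq : (0 : ℝ) < Fintype.card Fq := by exact_mod_cast Fintype.card_pos
    refine (Nat.cast_le.2 hle).trans (le_of_eq ?_)
    rw [show (r : ℤ) + s - m + 2 = ((r + s + 2 : ℕ) : ℤ) - (m : ℕ) by push_cast; ring,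
      zpow_sub₀ hq.ne', zpow_natCast, zpow_natCast, eq_div_iff (by positivity)]
    exact_mod_cast hcard
  · refine le_trans ?_ (le_max_left _ _)
    push Not at H
    rw [Nat.cast_le]
    rcases isEmpty_or_nonempty {v : Fin 2 → Polynomial Fq //
        v ∈ Γ ∧
        (¬ ∃ (a : Polynomial Fq) (w : Fin 2 → Polynomial Fq),
            w ∈ Γ ∧ 1 ≤ a.degree ∧ v = a • w) ∧
        (v 0).degree ≤ (r : WithBot ℕ) ∧ (v 1).degree ≤ (s : WithBot ℕ)} with hE | ⟨⟨v, hv⟩⟩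
    · rw [Nat.card_of_isEmpty]
      exact Nat.zero_le _
    · have hc := fun x : {v : Fin 2 → Polynomial Fq //
        v ∈ Γ ∧
        (¬ ∃ (a : Polynomial Fq) (w : Fin 2 → Polynomial Fq),
            w ∈ Γ ∧ 1 ≤ a.degree ∧ v = a • w) ∧
        (v 0).degree ≤ (r : WithBot ℕ) ∧ (v 1).degree ≤ (s : WithBot ℕ)} =>
        stmt_2_collinear Fq Γ v x.1 hv.1 x.2.1 hv.2.1 x.2.2.1
          (H v x.1 hv.1 x.2.1 hv.2.2.1 hv.2.2.2 x.2.2.2.1 x.2.2.2.2)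
      choose c hc using hc
      rw [← Nat.card_eq_fintype_card]
      refine Nat.card_le_card_of_injective c ?_
      intro x y hxy
      apply Subtype.ext
      rw [hc x, hc y, hxy]
end

section
/- Let F_q be a finite field, let Q ∈ F_q[x] be a polynomial with deg Q ≥ 1, let a ∈ F_q[x] be coprime with Q, and let r, s ≥ 0 be integers with r + s ≥ deg Q − 1. Then there exists a pair (g, h) ∈ F_q[x]^2 with deg g ≤ r, deg h ≤ s, satisfying the congruence h ≡ a·g (mod Q), and such that (g, h) is not congruent to (0, 0) modulo Q (i.e., Q does not divide both g and h). -/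
open Polynomial

/-- Let `Q ∈ F_q[x]` with `deg Q ≥ 1`, let `a ∈ F_q[x]` be coprime with `Q`, and let
`r, s ≥ 0` be integers with `r + s ≥ deg Q − 1`. Then there is a pair `(g, h)` with
`deg g ≤ r`, `deg h ≤ s`, `h ≡ a·g (mod Q)`, and `(g, h)` not congruent to `(0,0)` mod `Q`. -/
theorem stmt_4 (Fq : Type*) [Field Fq] [Fintype Fq] (Q a : Polynomial Fq)
    (hQ : 1 ≤ Q.natDegree) (ha : IsCoprime a Q) (r s : ℕ)
    (hrs : Q.natDegree ≤ r + s + 1) :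
    ∃ g h : Polynomial Fq, g.degree ≤ (r : WithBot ℕ) ∧ h.degree ≤ (s : WithBot ℕ) ∧
      Q ∣ (h - a * g) ∧ ¬ (Q ∣ g ∧ Q ∣ h) := by
  have hQ0 : Q ≠ 0 := by
    rintro rfl
    simp at hQ
  have small : ∀ p : Polynomial Fq, ∀ n : ℕ, n ≤ Q.natDegree → p.degree < (n : WithBot ℕ) →
      Q ∣ p → p = 0 := by
    intro p n hn hp hd
    refine eq_zero_of_dvd_of_degree_lt hd (hp.trans_le ?_)
    rw [degree_eq_natDegree hQ0]
    exact_mod_cast hn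
  have le_of_lt : ∀ p : Polynomial Fq, ∀ m n : ℕ, m ≤ n + 1 → p.degree < (m : WithBot ℕ) →
      p.degree ≤ (n : WithBot ℕ) := by
    intro p m n hmn hp
    rw [degree_le_iff_coeff_zero]
    intro k hk
    rw [degree_lt_iff_coeff_zero] at hp
    apply hp
    have : n < k := by exact_mod_cast hk
    omega
  by_cases hs : Q.natDegree ≤ s + 1
  · refine ⟨1, a % Q, ?_, ?_, ?_, ?_⟩
    · rw [degree_one]
      exact_mod_cast Nat.zero_le r
    · refine le_of_lt _ _ _ hs ?_
      rw [← degree_eq_natDegree hQ0]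
      exact EuclideanDomain.mod_lt a hQ0
    · refine ⟨-(a / Q), ?_⟩
      have := EuclideanDomain.div_add_mod a Q
      linear_combination this
    · rintro ⟨h1, -⟩
      have := natDegree_eq_zero_of_isUnit (isUnit_of_dvd_one h1)
      omega
  · obtain ⟨m, hm, hmr, hms⟩ : ∃ m, m ≤ Q.natDegree ∧ m ≤ r + 1 ∧ Q.natDegree < m + (s + 1) :=
      ⟨min (r + 1) Q.natDegree, by omega, by omega, by omega⟩
    let φ : Polynomial Fq →ₗ[Fq] AdjoinRoot Q := (AdjoinRoot.mkₐ Q).toLinearMap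
    let f : (degreeLT Fq m × degreeLT Fq (s + 1)) →ₗ[Fq] AdjoinRoot Q :=
      φ ∘ₗ ((degreeLT Fq (s + 1)).subtype ∘ₗ LinearMap.snd _ _ _
        - LinearMap.mulLeft Fq a ∘ₗ (degreeLT Fq m).subtype ∘ₗ LinearMap.fst _ _ _)
    haveI : Module.Finite Fq (AdjoinRoot Q) := (AdjoinRoot.powerBasis hQ0).finite
    haveI (n : ℕ) : Module.Finite Fq (degreeLT Fq n) :=
      Module.Finite.equiv (degreeLTEquiv Fq n).symm
    have hd (n : ℕ) : Module.finrank Fq (degreeLT Fq n) = n := by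
      rw [(degreeLTEquiv Fq n).finrank_eq]; simp
    have hk : LinearMap.ker f ≠ ⊥ := by
      apply LinearMap.ker_ne_bot_of_finrank_lt
      rw [Module.finrank_prod, hd, hd, (AdjoinRoot.powerBasis hQ0).finrank]
      simpa using hms
    obtain ⟨⟨⟨g, hg⟩, ⟨h, hh⟩⟩, hx, hne⟩ := Submodule.exists_mem_ne_zero_of_ne_bot hk
    have hdvd : Q ∣ h - a * g := by
      rw [← AdjoinRoot.mk_eq_zero]
      exact hx
    rw [mem_degreeLT] at hg hh
    refine ⟨g, h, le_of_lt _ _ _ hmr hg, le_of_lt _ _ _ le_rfl hh, hdvd, ?_⟩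
    rintro ⟨h1, h2⟩
    have e1 := small g m hm hg h1
    have e2 := small h (s + 1) (by omega) hh h2
    subst e1 e2
    exact hne rfl
end

section
/- Let F_q be a finite field, let Γ ⊆ F_q[x]^n be an F_q[x]-lattice with volume vol(Γ) = q^m, and set μ = min{deg v : 0 ≠ v ∈ Γ}. Then for any real number s ≥ 0, the number of vectors v ∈ Γ with deg v ≤ s is at most q^{max(0, n(s+1)−m, (n−1)(s+1−μ))}. -/
open Polynomial

namespace Stmt5

variable {F : Type*} [Field F] {n : ℕ}

/-- Vectors all of whose coordinates have degree `< d`. -/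
noncomputable def P (F : Type*) [Field F] (n d : ℕ) : Submodule F (Fin n → F[X]) :=
  Submodule.pi Set.univ (fun _ => degreeLT F d)

/-- Lattice vectors all of whose coordinates have degree `< d`. -/
noncomputable def B (Γ : Submodule F[X] (Fin n → F[X])) (d : ℕ) : Submodule F (Fin n → F[X]) :=
  P F n d ⊓ Γ.restrictScalars F

/-- The vector of `d`-th coefficients. -/
noncomputable def c (F : Type*) [Field F] (n d : ℕ) : (Fin n → F[X]) →ₗ[F] (Fin n → F) :=
  LinearMap.pi (fun i => (lcoeff F d).comp (LinearMap.proj i))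

lemma c_apply (d : ℕ) (v : Fin n → F[X]) (i : Fin n) : c F n d v i = (v i).coeff d := rfl

lemma mem_P {d : ℕ} {v : Fin n → F[X]} : v ∈ P F n d ↔ ∀ i, ∀ k, d ≤ k → (v i).coeff k = 0 := by
  simp only [P, Submodule.mem_pi, Set.mem_univ, true_imp_iff, mem_degreeLT, degree_lt_iff_coeff_zero]

lemma mem_B {Γ : Submodule F[X] (Fin n → F[X])} {d : ℕ} {v : Fin n → F[X]} :
    v ∈ B Γ d ↔ v ∈ P F n d ∧ v ∈ Γ := by
  simp [B]

/-- `P` as a function space. -/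
noncomputable def PEquiv (F : Type*) [Field F] (n d : ℕ) : P F n d ≃ₗ[F] (Fin n → degreeLT F d) where
  toFun v i := ⟨v.1 i, v.2 i (Set.mem_univ i)⟩
  invFun w := ⟨fun i => (w i).1, fun i _ => (w i).2⟩
  map_add' _ _ := rfl
  map_smul' _ _ := rfl
  left_inv _ := rfl
  right_inv _ := rfl

instance (d : ℕ) : FiniteDimensional F (degreeLT F d) :=
  Module.Finite.equiv (degreeLTEquiv F d).symm

instance finP (d : ℕ) : FiniteDimensional F (P F n d) :=
  Module.Finite.equiv (PEquiv F n d).symm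

lemma finrank_P (d : ℕ) : Module.finrank F (P F n d) = n * d := by
  rw [(PEquiv F n d).finrank_eq, Module.finrank_pi_fintype]
  simp [(degreeLTEquiv F d).finrank_eq]

instance finB (Γ : Submodule F[X] (Fin n → F[X])) (d : ℕ) : FiniteDimensional F (B Γ d) :=
  Submodule.finiteDimensional_of_le (inf_le_left : B Γ d ≤ P F n d)

variable (Γ : Submodule F[X] (Fin n → F[X]))

/-- Space of leading coefficients. -/
noncomputable def L (d : ℕ) : Submodule F (Fin n → F) := (B Γ (d + 1)).map (c F n d)

lemma finrank_step (d : ℕ) :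
    Module.finrank F (B Γ (d + 1)) = Module.finrank F (L Γ d) + Module.finrank F (B Γ d) := by
  have h := LinearMap.finrank_range_add_finrank_ker ((c F n d).domRestrict (B Γ (d + 1)))
  have h1 : LinearMap.range ((c F n d).domRestrict (B Γ (d + 1))) = L Γ d := by
    rw [LinearMap.range_domRestrict]; rfl
  have h2 : (LinearMap.ker ((c F n d).domRestrict (B Γ (d + 1)))).map (B Γ (d+1)).subtype
      = B Γ d := by
    ext v
    simp only [Submodule.mem_map, LinearMap.mem_ker, LinearMap.domRestrict_apply,
      Submodule.subtype_apply, Subtype.exists, exists_and_left, exists_prop, mem_B]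
    constructor
    · rintro ⟨w, hw, ⟨h1, h2⟩, rfl⟩
      refine ⟨?_, h2⟩
      rw [mem_P] at h1 ⊢
      intro i k hk
      rcases hk.eq_or_lt with rfl | hk
      · exact congrFun hw i
      · exact h1 i k hk
    · rintro ⟨h1, h2⟩
      rw [mem_P] at h1
      refine ⟨v, ?_, ⟨?_, h2⟩, rfl⟩
      · ext i; exact h1 i d le_rfl
      · rw [mem_P]; intro i k hk; exact h1 i k (by omega)
  rw [h1, ← Submodule.finrank_map_subtype_eq, h2] at h
  exact h.symm

lemma shift {d k : ℕ} {w : Fin n → F[X]} (hw : w ∈ B Γ (d + 1)) :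
    ((X : F[X]) ^ k • w) ∈ B Γ (d + k + 1) ∧
      c F n (d + k) ((X : F[X]) ^ k • w) = c F n d w := by
  rw [mem_B, mem_P] at hw
  refine ⟨?_, ?_⟩
  · rw [mem_B, mem_P]
    refine ⟨fun i j hj => ?_, Γ.smul_mem _ hw.2⟩
    obtain ⟨l, rfl⟩ : ∃ l, j = l + k := ⟨j - k, by omega⟩
    simp only [Pi.smul_apply, smul_eq_mul, coeff_X_pow_mul]
    exact hw.1 i l (by omega)
  · ext i
    simp [c_apply, coeff_X_pow_mul]

lemma L_mono {j d : ℕ} (h : j ≤ d) : L Γ j ≤ L Γ d := by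
  obtain ⟨k, rfl⟩ := Nat.exists_eq_add_of_le h
  rintro _ ⟨w, hw, rfl⟩
  exact ⟨_, (shift Γ hw).1, (shift Γ hw).2⟩

lemma P_le (d : ℕ) (hL : L Γ d = ⊤) (k : ℕ) :
    P F n (d + k + 1) ≤ P F n (d + 1) ⊔ Γ.restrictScalars F := by
  induction k with
  | zero => exact le_sup_left
  | succ k ih =>
    intro v hv
    have hu : c F n (d + (k + 1)) v ∈ L Γ d := by rw [hL]; trivial
    obtain ⟨w, hw, hwv⟩ := hu
    have hs := shift Γ (k := k + 1) hw
    rw [← sub_add_cancel v ((X : F[X]) ^ (k + 1) • w)]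
    refine Submodule.add_mem _ (ih ?_) (Submodule.mem_sup_right (mem_B.1 hs.1).2)
    have h1 := mem_P.1 (mem_B.1 hs.1).1
    rw [mem_P] at hv ⊢
    intro i j hj
    rcases hj.eq_or_lt with rfl | hj
    · have := congrFun (hs.2.trans hwv) i
      rw [c_apply, c_apply] at this
      rw [Pi.sub_apply, coeff_sub, sub_eq_zero]
      exact this.symm
    · rw [Pi.sub_apply, coeff_sub, hv i j (by omega), h1 i j (by omega), sub_zero]

lemma sup_top (d : ℕ) (hL : L Γ d = ⊤) : P F n (d + 1) ⊔ Γ.restrictScalars F = ⊤ := by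
  rw [eq_top_iff]
  intro v _
  refine P_le Γ d hL (Finset.univ.sup fun i => (v i).natDegree) (mem_P.2 fun i k hk => ?_)
  apply coeff_eq_zero_of_natDegree_lt
  have := Finset.le_sup (f := fun i => (v i).natDegree) (Finset.mem_univ i)
  omega

lemma case_one [Fintype F] (m d : ℕ)
    (hvol : Nat.card ((Fin n → F[X]) ⧸ Γ) = Fintype.card F ^ m) (hL : L Γ d = ⊤) :
    m + Module.finrank F (B Γ (d + 1)) = n * (d + 1) := by
  let f := ((Γ.restrictScalars F).mkQ).domRestrict (P F n (d + 1))
  have hr : LinearMap.range f = ⊤ := by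
    rw [LinearMap.range_domRestrict, ← (Submodule.range_mkQ (Γ.restrictScalars F)),
      LinearMap.range_eq_map, ← sup_top Γ d hL, Submodule.map_sup]
    simp
  have hk : (LinearMap.ker f).map (P F n (d+1)).subtype = B Γ (d + 1) := by
    ext v
    simp only [f, Submodule.mem_map, LinearMap.mem_ker, LinearMap.domRestrict_apply,
      Submodule.subtype_apply, Subtype.exists, exists_and_left, exists_prop, mem_B,
      Submodule.mkQ_apply, Submodule.Quotient.mk_eq_zero, Submodule.restrictScalars_mem]
    constructor
    · rintro ⟨w, hw, h, rfl⟩; exact ⟨h, hw⟩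
    · rintro ⟨h, hw⟩; exact ⟨v, hw, h, rfl⟩
  have h := LinearMap.finrank_range_add_finrank_ker f
  rw [← Submodule.finrank_map_subtype_eq, hk, hr, finrank_top, finrank_P] at h
  have hfin : Module.Finite F ((Fin n → F[X]) ⧸ Γ.restrictScalars F) :=
    Module.Finite.of_surjective f (LinearMap.range_eq_top.1 hr)
  have hc : Nat.card ((Fin n → F[X]) ⧸ Γ.restrictScalars F) = Fintype.card F ^ m := hvol
  rw [Module.natCard_eq_pow_finrank (K := F), Nat.card_eq_fintype_card] at hc
  rw [Nat.pow_right_injective (Fintype.one_lt_card (α := F)) hc] at h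
  exact h

lemma finrank_case_two (d μ : ℕ) (hL : L Γ d ≠ ⊤) (hμ : B Γ μ = ⊥) (k : ℕ) (hk : μ + k ≤ d + 1) :
    Module.finrank F (B Γ (μ + k)) ≤ (n - 1) * k := by
  induction k with
  | zero => simp [hμ]
  | succ k ih =>
    have h1 := ih (by omega)
    have h2 : L Γ (μ + k) < ⊤ := lt_of_le_of_lt (L_mono Γ (by omega)) hL.lt_top
    have h3 := Submodule.finrank_lt_finrank_of_lt h2
    rw [finrank_top, Module.finrank_fin_fun] at h3
    rw [← add_assoc, finrank_step, mul_add]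
    omega

lemma B_mono {a b : ℕ} (h : a ≤ b) : B Γ a ≤ B Γ b := by
  intro v hv
  rw [mem_B, mem_P] at *
  exact ⟨fun i k hk => hv.1 i k (by omega), hv.2⟩

lemma B_bot (μ : ℕ) 
    (hμ : IsLeast {k : ℕ | ∃ v : Fin n → F[X], v ∈ Γ ∧ v ≠ 0 ∧
        (Finset.univ.sup fun i => (v i).degree) = (k : WithBot ℕ)} μ) : B Γ μ = ⊥ := by
  rw [eq_bot_iff]
  intro v hv
  rw [Submodule.mem_bot]
  by_contra hne
  rw [mem_B, mem_P] at hv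
  have hlt : (Finset.univ.sup fun i => (v i).degree) < (μ : WithBot ℕ) := by
    refine (Finset.sup_lt_iff (WithBot.bot_lt_coe μ)).2 ?_
    intro i _
    exact (degree_lt_iff_coeff_zero _ _).2 (hv.1 i)
  obtain ⟨i, hi⟩ := Function.ne_iff.1 hne
  have hle := Finset.le_sup (f := fun i => (v i).degree) (Finset.mem_univ i)
  cases hk : (Finset.univ.sup fun i => (v i).degree) with
  | bot =>
    rw [hk, le_bot_iff, degree_eq_bot] at hle
    exact hi hle
  | coe k =>
    have := hμ.2 ⟨v, hv.2, hne, hk⟩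
    rw [hk] at hlt
    have h2 : k < μ := WithBot.coe_lt_coe.1 hlt
    omega

end Stmt5

/-- Let `Γ ⊆ F_q[x]^n` be an `F_q[x]`-lattice with volume `q^m`, and let
`μ = min{deg v : 0 ≠ v ∈ Γ}`. Then for any real `s ≥ 0`, the number of `v ∈ Γ` with
`deg v ≤ s` is at most `q^{max(0, n(s+1)−m, (n−1)(s+1−μ))}`. -/
theorem stmt_5 (Fq : Type*) [Field Fq] [Fintype Fq] (n m μ : ℕ) (hn : 0 < n)
    (Γ : Submodule (Polynomial Fq) (Fin n → Polynomial Fq))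
    (hvol : Nat.card ((Fin n → Polynomial Fq) ⧸ Γ) = Fintype.card Fq ^ m)
    (hμ : IsLeast {k : ℕ | ∃ v : Fin n → Polynomial Fq, v ∈ Γ ∧ v ≠ 0 ∧
        (Finset.univ.sup fun i => (v i).degree) = (k : WithBot ℕ)} μ)
    (s : ℝ) (hs : 0 ≤ s) :
    (Nat.card {v : Fin n → Polynomial Fq // v ∈ Γ ∧
        ∀ i, v i = 0 ∨ ((v i).natDegree : ℝ) ≤ s} : ℝ) ≤
      (Fintype.card Fq : ℝ) ^
        (max 0 (max ((n : ℝ) * (s + 1) - (m : ℝ)) (((n : ℝ) - 1) * (s + 1 - (μ : ℝ))))) := by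
  classical
  have hset : ∀ v : Fin n → Polynomial Fq, (v ∈ Γ ∧ ∀ i, v i = 0 ∨ ((v i).natDegree : ℝ) ≤ s) ↔
      v ∈ Stmt5.B Γ (⌊s⌋₊ + 1) := by
    intro v
    rw [Stmt5.mem_B, Stmt5.mem_P, and_comm]
    refine and_congr_left fun _ => forall_congr' fun i => ?_
    rw [← degree_lt_iff_coeff_zero]
    by_cases h0 : v i = 0
    · simp [h0, WithBot.bot_lt_coe]
    · rw [degree_eq_natDegree h0, Nat.cast_lt, Nat.lt_succ_iff, Nat.le_floor_iff hs]
      simp [h0]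
  rw [Nat.card_congr (Equiv.subtypeEquivRight hset)]
  have hcard := Module.natCard_eq_pow_finrank (K := Fq) (V := Stmt5.B Γ (⌊s⌋₊ + 1))
  change ((Nat.card (Stmt5.B Γ (⌊s⌋₊ + 1)) : ℕ) : ℝ) ≤ _
  rw [hcard, Nat.card_eq_fintype_card]
  push_cast
  rw [← Real.rpow_natCast]
  apply Real.rpow_le_rpow_of_exponent_le
  · exact_mod_cast (Fintype.one_lt_card (α := Fq)).le
  have hfl := Nat.floor_le hs
  have hn1 : (1 : ℝ) ≤ n := by exact_mod_cast hn
  by_cases hL : Stmt5.L Γ ⌊s⌋₊ = ⊤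
  · have h := Stmt5.case_one Γ m _ hvol hL
    have h' : (m : ℝ) + Module.finrank Fq (Stmt5.B Γ (⌊s⌋₊ + 1)) = n * ((⌊s⌋₊ : ℝ) + 1) := by
      exact_mod_cast h
    refine le_trans ?_ ((le_max_left _ _).trans (le_max_right _ _))
    nlinarith
  · have hbot := Stmt5.B_bot Γ μ hμ
    rcases le_total μ (⌊s⌋₊ + 1) with hle | hle
    · obtain ⟨k, hk⟩ := Nat.exists_eq_add_of_le hle
      have h := Stmt5.finrank_case_two Γ _ μ hL hbot k hk.ge
      rw [hk]
      have h' : (Module.finrank Fq (Stmt5.B Γ (μ + k)) : ℝ) ≤ ((n : ℝ) - 1) * k := by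
        have := (Nat.cast_le (α := ℝ)).2 h
        rw [Nat.cast_mul, Nat.cast_sub hn] at this
        simpa using this
      have hk' : (⌊s⌋₊ : ℝ) + 1 = μ + k := by exact_mod_cast hk
      refine le_trans ?_ ((le_max_right _ _).trans (le_max_right _ _))
      nlinarith
    · have : Stmt5.B Γ (⌊s⌋₊ + 1) = ⊥ := by
        rw [eq_bot_iff, ← hbot]; exact Stmt5.B_mono Γ hle
      rw [this]
      simp
end

section
/- Let F_q be a finite field, let g ∈ F_q[x] be a monic squarefree polynomial of degree d ≥ 1, and let h ∈ F_q[x] with deg h < d. Let c_1, c_2 ∈ F_q[x] be monic polynomials, each coprime with g, such that c_1 ≡ c_2 (mod g^2). Then the sums over the roots (with multiplicity) in an algebraic closure of F_q satisfy ∑_{α : c_1(α)=0} h(α)/g(α) = ∑_{α : c_2(α)=0} h(α)/g(α). (In particular, for f = h/g with deg h < deg g = d and g squarefree, the value ∑_{c(α)=0} f(α) depends only on the residue class of c modulo g^2, so the associated character χ_f is a Dirichlet character modulo g^2.) -/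
open Polynomial

/-- Partial fractions and the logarithmic derivative: the sum over the roots of `c` in terms of
`c'(β)/c(β)` at the roots `β` of `g`. -/
theorem sum_roots_eq {K : Type*} [Field K] [DecidableEq K] [IsAlgClosed K] (g h c : K[X])
    (hg : g.Monic) (hgs : g.Separable) (hh : h.degree < g.degree) (hc : c ≠ 0)
    (hcg : IsCoprime c g) :
    (c.roots.map (fun α => h.eval α / g.eval α)).sum =
      ∑ β ∈ (⟨g.roots, nodup_roots hgs⟩ : Finset K),
        -(Lagrange.nodalWeight (⟨g.roots, nodup_roots hgs⟩ : Finset K) id β * h.eval β) *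
          (c.derivative.eval β / c.eval β) := by
  set s : Finset K := ⟨g.roots, nodup_roots hgs⟩ with hs
  have hne : ∀ x : K, c.eval x = 0 → g.eval x ≠ 0 := by
    intro x h1 h2
    obtain ⟨a, b, hab⟩ := hcg
    have := congrArg (eval x) hab
    simp [h1, h2] at this
  have hnodal : Lagrange.nodal s id = g := by
    rw [Lagrange.nodal_eq]
    exact ((IsAlgClosed.splits g).eq_prod_roots_of_monic hg).symm
  have hcard : (s.card : WithBot ℕ) = g.degree := by
    rw [degree_eq_natDegree hg.ne_zero, (IsAlgClosed.splits g).natDegree_eq_card_roots]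
    rfl
  have hint : h = Lagrange.interpolate s id (fun i => eval (id i) h) :=
    Lagrange.eq_interpolate (Function.injective_id.injOn) (by rw [hcard]; exact hh)
  have key : ∀ α ∈ c.roots, h.eval α / g.eval α =
      (g.roots.map fun β => Lagrange.nodalWeight s id β * (α - β)⁻¹ * h.eval β).sum := by
    intro α hα
    have h0 : c.eval α = 0 := (mem_roots hc).1 hα
    have hgα := hne α h0
    have hx : ∀ i ∈ s, α ≠ id i := by
      rintro i hi rfl
      exact hgα ((mem_roots hg.ne_zero).1 hi)
    have := Lagrange.eval_interpolate_not_at_node (fun i => eval (id i) h) hx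
    rw [← hint, hnodal] at this
    rw [this, mul_div_cancel_left₀ _ hgα]
    rfl
  rw [Multiset.map_congr rfl key, Multiset.sum_map_sum_map]
  change _ = (g.roots.map _).sum
  refine congrArg _ (Multiset.map_congr rfl fun β hβ => ?_)
  have hcβ : c.eval β ≠ 0 := fun h0 => hne β h0 ((mem_roots hg.ne_zero).1 hβ)
  rw [(IsAlgClosed.splits c).eval_derivative_div_eval_of_ne_zero hcβ, ← Multiset.sum_map_mul_left]
  refine congrArg _ (Multiset.map_congr rfl fun α _ => ?_)
  rw [← neg_sub β α, inv_neg]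
  ring

/-- Let `g ∈ F_q[x]` be monic squarefree of degree `d ≥ 1`, `h ∈ F_q[x]` with `deg h < d`.
If `c₁, c₂` are monic polynomials coprime with `g` with `c₁ ≡ c₂ (mod g²)`, then the sums
over the roots (with multiplicity, in an algebraic closure of `F_q`) of `h(α)/g(α)` agree:
`∑_{c₁(α)=0} h(α)/g(α) = ∑_{c₂(α)=0} h(α)/g(α)`. -/
theorem stmt_6 (Fq : Type*) [Field Fq] [Fintype Fq] (d : ℕ) (hd : 1 ≤ d)
    (g h : Polynomial Fq) (hg : g.Monic) (hgsf : Squarefree g) (hgd : g.natDegree = d)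
    (hh : h.natDegree < d)
    (c₁ c₂ : Polynomial Fq) (hc₁ : c₁.Monic) (hc₂ : c₂.Monic)
    (hc₁g : IsCoprime c₁ g) (hc₂g : IsCoprime c₂ g)
    (hcong : g ^ 2 ∣ c₁ - c₂) :
    ((c₁.map (algebraMap Fq (AlgebraicClosure Fq))).roots.map
        (fun α => (h.map (algebraMap Fq (AlgebraicClosure Fq))).eval α /
          (g.map (algebraMap Fq (AlgebraicClosure Fq))).eval α)).sum =
      ((c₂.map (algebraMap Fq (AlgebraicClosure Fq))).roots.map
        (fun α => (h.map (algebraMap Fq (AlgebraicClosure Fq))).eval α /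
          (g.map (algebraMap Fq (AlgebraicClosure Fq))).eval α)).sum := by
  classical
  have hgs : (g.map (algebraMap Fq (AlgebraicClosure Fq))).Separable :=
    (PerfectField.separable_iff_squarefree.2 hgsf).map
  have hdeg : (h.map (algebraMap Fq (AlgebraicClosure Fq))).degree <
      (g.map (algebraMap Fq (AlgebraicClosure Fq))).degree := by
    rw [degree_map, degree_map, degree_eq_natDegree hg.ne_zero, hgd]
    exact lt_of_le_of_lt degree_le_natDegree (by exact_mod_cast hh)
  rw [sum_roots_eq _ _ _ (hg.map _) hgs hdeg (hc₁.map _).ne_zero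
      (hc₁g.map (mapRingHom (algebraMap Fq (AlgebraicClosure Fq)))),
    sum_roots_eq _ _ _ (hg.map _) hgs hdeg (hc₂.map _).ne_zero
      (hc₂g.map (mapRingHom (algebraMap Fq (AlgebraicClosure Fq))))]
  refine Finset.sum_congr rfl fun β hβ => ?_
  have hgβ : (g.map (algebraMap Fq (AlgebraicClosure Fq))).eval β = 0 :=
    (mem_roots (hg.map _).ne_zero).1 hβ
  obtain ⟨k, hk⟩ := hcong
  have hc : c₁ = c₂ + g ^ 2 * k := by rw [← hk]; ring
  have e1 : (c₁.map (algebraMap Fq (AlgebraicClosure Fq))).eval β =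
      (c₂.map (algebraMap Fq (AlgebraicClosure Fq))).eval β := by
    rw [hc]; simp [hgβ, -eval_map_algebraMap]
  have e2 : (c₁.map (algebraMap Fq (AlgebraicClosure Fq))).derivative.eval β =
      (c₂.map (algebraMap Fq (AlgebraicClosure Fq))).derivative.eval β := by
    rw [hc]
    simp only [Polynomial.map_add, Polynomial.map_mul, Polynomial.map_pow, derivative_add,
      derivative_mul, derivative_pow, eval_add, eval_mul, eval_pow, hgβ]
    simp
  rw [e1, e2]
end

section
/- Let p > 2 be a prime, q a power of p, let g ∈ F_q[x] be a monic squarefree polynomial of degree d ≥ 1, and let h ∈ F_q[x] be a nonzero polynomial with deg h < d and gcd(h, g) = 1. Then there exist an integer r ≥ 1 and an element α ∈ F_{q^r} with g(α) ≠ 0 such that Tr_{F_{q^r}/F_p}(h(α)/g(α)) ≠ 0. (This is the key step showing that the map f ↦ χ_f is injective on the family H_g = {h/g : deg h < d, gcd(h,g) = 1}.) -/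
open Polynomial

theorem aux_newton {Ω : Type*} [Field Ω] {n : ℕ} (s t : Fin n → Ω)
    (H : ∀ k < n, (Multiset.map s Finset.univ.val).esymm k = (Multiset.map t Finset.univ.val).esymm k) :
    ∀ j < n, ∑ i, s i ^ j = ∑ i, t i ^ j := by
  intro j
  induction j using Nat.strong_induction_on with
  | _ j ih =>
    intro hj
    rcases Nat.eq_zero_or_pos j with rfl | hpos
    · simp
    have key : ∀ u : Fin n → Ω, ∀ k, ∑ i, u i ^ k = MvPolynomial.aeval u (MvPolynomial.psum (Fin n) Ω k) := by
      intro u k; simp [MvPolynomial.psum]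
    rw [key, key, MvPolynomial.psum_eq_mul_esymm_sub_sum _ _ _ hpos]
    simp only [map_sub, map_mul, map_sum, map_pow, map_neg, map_one, map_natCast,
      MvPolynomial.aeval_esymm_eq_multiset_esymm, ← key]
    rw [H j hj]
    congr 1
    apply Finset.sum_congr rfl
    intro a ha
    rw [Finset.mem_filter, Finset.HasAntidiagonal.mem_antidiagonal, Set.mem_Ioo] at ha
    rw [H a.1 (by omega), ih a.2 (by omega) (by omega)]

theorem aux_ms {Ω : Type*} [Field Ω] {n : ℕ} (A : Multiset Ω) (hA : A.card = n) :
    ∃ s : Fin n → Ω, A = Multiset.map s Finset.univ.val := by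
  obtain ⟨l, rfl⟩ : ∃ l : List Ω, A = (l : Multiset Ω) := ⟨A.toList, A.coe_toList.symm⟩
  rw [Multiset.coe_card] at hA
  subst hA
  refine ⟨l.get, ?_⟩
  rw [Fin.univ_val_map, List.ofFn_get]

theorem aux_newton' {Ω : Type*} [Field Ω] {n : ℕ} (A B : Multiset Ω) (hA : A.card = n)
    (hB : B.card = n) (H : ∀ k < n, A.esymm k = B.esymm k) (P : Polynomial Ω) (hP : P.natDegree < n) :
    (A.map (fun x => P.eval x)).sum = (B.map (fun x => P.eval x)).sum := by
  obtain ⟨s, rfl⟩ := aux_ms A hA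
  obtain ⟨t, rfl⟩ := aux_ms B hB
  have := aux_newton s t H
  have e : ∀ u : Fin n → Ω, (Multiset.map (fun x => P.eval x) (Multiset.map u Finset.univ.val)).sum
      = ∑ j ∈ Finset.range n, P.coeff j * ∑ i, u i ^ j := by
    intro u
    rw [Multiset.map_map]
    change ∑ i, P.eval (u i) = _
    simp_rw [Finset.mul_sum]
    rw [Finset.sum_comm]
    exact Finset.sum_congr rfl fun i _ => eval_eq_sum_range' hP _
  rw [e, e]
  exact Finset.sum_congr rfl fun j hj => by rw [this j (Finset.mem_range.1 hj)]

/-- sum of the values of `P` over the roots of `m` -/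
noncomputable def auxS {F : Type} [Field F] (m P : F[X]) : AlgebraicClosure F :=
  ((m.aroots (AlgebraicClosure F)).map (fun x => aeval x P)).sum

theorem auxS_shift {F : Type} [Field F] (m P : F[X]) (hm : m.Monic) (hP : P.natDegree < m.natDegree) :
    auxS (m + 1) P = auxS m P := by
  have hd : (m + 1).natDegree = m.natDegree := natDegree_add_C (a := 1)
  have hpos : 0 < m.natDegree := by omega
  have hm1 : (m + 1).Monic := by
    rw [Monic, leadingCoeff, hd, coeff_add, coeff_one, if_neg (by omega), add_zero]; exact hm
  have key := aux_newton' (n := m.natDegree) ((m+1).aroots (AlgebraicClosure F))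
    (m.aroots (AlgebraicClosure F)) (by rw [IsAlgClosed.card_aroots_eq_natDegree, hd])
    IsAlgClosed.card_aroots_eq_natDegree ?_ (P.map (algebraMap _ _)) (by rwa [natDegree_map])
  · simpa [auxS, aeval_def, eval_map] using key
  intro k hk
  have e : ∀ m' : F[X], m'.Monic → m'.natDegree = m.natDegree →
      (m'.aroots (AlgebraicClosure F)).esymm k = (-1)^k * algebraMap F _ (m'.coeff (m.natDegree - k)) := by
    intro m' h1 h2
    have h3 := coeff_eq_esymm_roots_of_card (p := m'.map (algebraMap F (AlgebraicClosure F)))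
      IsAlgClosed.card_roots_eq_natDegree (k := m.natDegree - k) (by rw [natDegree_map]; omega)
    rw [natDegree_map, (h1.map _).leadingCoeff, coeff_map, h2, Nat.sub_sub_self hk.le] at h3
    rw [h3, one_mul, ← mul_assoc, ← mul_pow]; simp
  rw [e _ hm1 hd, e _ hm rfl, coeff_add, coeff_one, if_neg (by omega), add_zero]

theorem auxS_mul {F : Type} [Field F] (a b P : F[X]) (h : a * b ≠ 0) :
    auxS (a * b) P = auxS a P + auxS b P := by
  simp [auxS, aroots_mul h]

theorem auxS_congr {F : Type} [Field F] (a P Q : F[X]) (h : a ∣ P - Q) :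
    auxS a P = auxS a Q := by
  unfold auxS
  congr 1
  apply Multiset.map_congr rfl
  intro x hx
  obtain ⟨c, hc⟩ := h
  have hx := (mem_aroots'.1 hx).2
  have := congrArg (aeval x) hc
  simp only [map_sub, map_mul, hx, zero_mul] at this
  exact sub_eq_zero.1 this

theorem auxS_zero {F : Type} [Field F] (a P : F[X]) (h : a ∣ P) : auxS a P = 0 := by
  rw [auxS_congr a P 0 (by simpa using h)]; simp [auxS]

theorem auxS_irr {F : Type} [Field F] [Finite F] (μ P : F[X]) [Fact (Irreducible μ)] :
    auxS μ P = algebraMap F _ (Algebra.trace F (AdjoinRoot μ) (AdjoinRoot.mk μ P)) := by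
  have hirr : Irreducible μ := Fact.out
  have : FiniteDimensional F (AdjoinRoot μ) := (AdjoinRoot.powerBasis hirr.ne_zero).finite
  rw [trace_eq_sum_embeddings (AlgebraicClosure F)]
  have hsep : μ.Separable := PerfectField.separable_of_irreducible hirr
  have hnd : (μ.aroots (AlgebraicClosure F)).Nodup := nodup_roots hsep.map
  classical
  rw [← Equiv.sum_comp (AdjoinRoot.equiv (AlgebraicClosure F) F μ hirr.ne_zero).symm]
  have e : ∀ x, ((AdjoinRoot.equiv (AlgebraicClosure F) F μ hirr.ne_zero).symm x) (AdjoinRoot.mk μ P)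
      = aeval (x : AlgebraicClosure F) P := by
    intro x
    set σ := (AdjoinRoot.equiv (AlgebraicClosure F) F μ hirr.ne_zero).symm x with hσ
    have hx : x = AdjoinRoot.equiv (AlgebraicClosure F) F μ hirr.ne_zero σ := by simp [hσ]
    have : (x : AlgebraicClosure F) = σ (AdjoinRoot.root μ) := by
      rw [hx]; rfl
    rw [this, aeval_algHom_apply, AdjoinRoot.aeval_eq]
  simp_rw [e]
  unfold auxS
  rw [← Finset.sum_subtype (μ.aroots (AlgebraicClosure F)).toFinset (fun x => Multiset.mem_toFinset)
    (fun x => aeval x P), Finset.sum, Multiset.toFinset_val, Multiset.dedup_eq_self.2 hnd]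

theorem aux_decomp {F : Type} [Field F] [Finite F] {B : Type*} [AddCommGroup B] (τ : F →+ B)
    (P : F[X]) (m : F[X]) :
    (∀ μ : F[X], ∀ h : Fact (Irreducible μ), μ ∣ m →
      τ (Algebra.trace F (AdjoinRoot μ) (AdjoinRoot.mk μ P)) = 0) →
    ∃ c : F, algebraMap F _ c = auxS m P ∧ τ c = 0 := by
  induction m using UniqueFactorizationMonoid.induction_on_prime with
  | h₁ => intro _; exact ⟨0, by simp [auxS], by simp⟩
  | h₂ x hx =>
    intro _
    obtain ⟨c, -, rfl⟩ := isUnit_iff.1 hx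
    exact ⟨0, by simp [auxS], by simp⟩
  | h₃ a q ha hq ih =>
    intro H
    obtain ⟨c, hc, hc0⟩ := ih fun μ h hd => H μ h (hd.mul_left q)
    have : Fact (Irreducible q) := ⟨hq.irreducible⟩
    refine ⟨Algebra.trace F (AdjoinRoot q) (AdjoinRoot.mk q P) + c, ?_, ?_⟩
    · rw [auxS_mul _ _ _ (mul_ne_zero hq.ne_zero ha), map_add, hc, auxS_irr q]
    · rw [map_add, hc0, H q inferInstance (dvd_mul_right _ _), add_zero]

theorem stmt_8 (p : ℕ) (hp : p.Prime) (hp2 : 2 < p)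
    (Fq : Type) [Field Fq] [Fintype Fq] [CharP Fq p]
    (d : ℕ) (hd : 1 ≤ d) (g h : Polynomial Fq) (hg : g.Monic) (hgsf : Squarefree g)
    (hgd : g.natDegree = d) (hh0 : h ≠ 0) (hhd : h.natDegree < d) (hcop : IsCoprime h g) :
    ∃ r : ℕ, 1 ≤ r ∧
      ∀ (K : Type) [Field K] [Algebra Fq K] [Algebra (ZMod p) K],
        Module.finrank Fq K = r →
          ∃ α : K, Polynomial.aeval α g ≠ 0 ∧
            Algebra.trace (ZMod p) K (Polynomial.aeval α h / Polynomial.aeval α g) ≠ 0 := by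
  have : Fact p.Prime := ⟨hp⟩
  letI : Algebra (ZMod p) Fq := ZMod.algebra Fq p
  obtain ⟨π, hπ, c, hc⟩ := exists_irreducible_of_natDegree_pos (f := g) (by omega)
  have hFπ : Fact (Irreducible π) := ⟨hπ⟩
  have hfdπ : FiniteDimensional Fq (AdjoinRoot π) := (AdjoinRoot.powerBasis hπ.ne_zero).finite
  obtain ⟨z, hz⟩ := Algebra.trace_surjective (ZMod p) Fq 1
  obtain ⟨y, hy⟩ := Algebra.trace_surjective Fq (AdjoinRoot π) z
  obtain ⟨Y, rfl⟩ := AdjoinRoot.mk_surjective y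
  have hcopc : IsCoprime π c := by
    rw [hπ.coprime_iff_not_dvd]
    rintro ⟨e, rfl⟩
    exact hπ.not_isUnit (hgsf π ⟨e, by rw [hc]; ring⟩)
  obtain ⟨u, v, huv⟩ := hcopc
  obtain ⟨a, b, hab⟩ := hcop
  have hg0 : g ≠ 0 := hg.ne_zero
  -- the polynomial `k`
  obtain ⟨k, hk, hkQ⟩ : ∃ k : Fq[X], k.Monic ∧ g ∣ h * k - v * c * Y := by
    refine ⟨X ^ ((a * (v * c * Y)).natDegree + 1) * g + a * (v * c * Y), ?_, ?_⟩
    · apply ((monic_X_pow _).mul hg).add_of_left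
      apply degree_lt_degree
      rw [((monic_X_pow _).natDegree_mul hg), natDegree_X_pow]
      omega
    · refine ⟨h * X ^ ((a * (v * c * Y)).natDegree + 1) - b * (v * c * Y), ?_⟩
      linear_combination (v * c * Y) * hab
  have hk0 := hk.ne_zero
  have hgk0 : g * k ≠ 0 := mul_ne_zero hg0 hk0
  have hS : auxS (g * k + 1) (h * k) = algebraMap Fq _ z := by
    rw [auxS_shift _ _ (hg.mul hk), auxS_mul _ _ _ hgk0, auxS_zero k _ (dvd_mul_left _ _), add_zero,
      auxS_congr g _ _ hkQ, hc, auxS_mul _ _ _ (hc ▸ hg0), auxS_zero c _ ⟨v * Y, by ring⟩, add_zero,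
      auxS_congr π _ Y ⟨-u * Y, by linear_combination Y * huv⟩, auxS_irr, hy]
    rw [hg.natDegree_mul hk, natDegree_mul hh0 hk0]
    omega
  obtain ⟨μ, hμ, hμd, hne⟩ : ∃ μ : Fq[X], ∃ _ : Fact (Irreducible μ), μ ∣ g * k + 1 ∧
      Algebra.trace (ZMod p) Fq (Algebra.trace Fq (AdjoinRoot μ) (AdjoinRoot.mk μ (h * k))) ≠ 0 := by
    by_contra! H
    obtain ⟨w, hw, hw0⟩ := aux_decomp (Algebra.trace (ZMod p) Fq).toAddMonoidHom (h * k) (g * k + 1)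
      (fun μ h hd => H μ h hd)
    rw [hS] at hw
    have := (algebraMap Fq (AlgebraicClosure Fq)).injective hw
    subst this
    change Algebra.trace (ZMod p) Fq w = 0 at hw0
    rw [hz] at hw0
    exact one_ne_zero hw0
  have hμ' : Irreducible μ := hμ.out
  have hfd : FiniteDimensional Fq (AdjoinRoot μ) := (AdjoinRoot.powerBasis hμ'.ne_zero).finite
  refine ⟨Module.finrank Fq (AdjoinRoot μ), Module.finrank_pos, ?_⟩
  intro K _ _ _ hK
  have hfdK : FiniteDimensional Fq K := Module.finite_of_finrank_pos (hK ▸ Module.finrank_pos)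
  have hfinK : Finite K := Module.finite_of_finite Fq
  obtain ⟨e0⟩ := FiniteField.nonempty_algHom_of_finrank_dvd (F := Fq) (K := AdjoinRoot μ) (L := K)
    (dvd_of_eq hK.symm)
  have hbij : Function.Bijective e0 := by
    refine ⟨e0.toRingHom.injective, ?_⟩
    exact (LinearMap.injective_iff_surjective_of_finrank_eq_finrank (f := e0.toLinearMap) hK.symm).1
      e0.toRingHom.injective
  let e := AlgEquiv.ofBijective e0 hbij
  have hev : ∀ P : Fq[X], aeval (e (AdjoinRoot.root μ)) P = e (AdjoinRoot.mk μ P) := by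
    intro P
    rw [← AdjoinRoot.aeval_eq, aeval_algHom_apply]
  have hroot : aeval (e (AdjoinRoot.root μ)) (g * k + 1) = 0 := by
    rw [hev, AdjoinRoot.mk_eq_zero.2 hμd, map_zero]
  simp only [map_add, map_mul, map_one] at hroot
  have hgα : aeval (e (AdjoinRoot.root μ)) g ≠ 0 := by
    intro h0
    rw [h0] at hroot
    simp at hroot
  refine ⟨e (AdjoinRoot.root μ), hgα, ?_⟩
  have hval : aeval (e (AdjoinRoot.root μ)) h / aeval (e (AdjoinRoot.root μ)) g
      = - e (AdjoinRoot.mk μ (h * k)) := by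
    rw [← hev, map_mul, div_eq_iff hgα]
    linear_combination (aeval (e (AdjoinRoot.root μ)) h) * hroot
  have : IsScalarTower (ZMod p) Fq K := IsScalarTower.of_algebraMap_eq' (Subsingleton.elim _ _)
  rw [hval, map_neg, neg_ne_zero, ← Algebra.trace_trace (S := Fq), Algebra.trace_eq_of_algEquiv]
  exact hne
end

section
/- Let p > 2 be a prime, q a power of p, and let d ≥ 1 be an integer coprime with p. Let Q denote either x^d or x^{d+1} in F_q[x]. Then a polynomial u ∈ F_q[x] with u(0) ≠ 0 satisfies that u mod Q is a p-th power in (F_q[x]/Q)^× if and only if u ≡ φ(x^p) (mod Q) for some polynomial φ ∈ F_q[x] with φ(0) ≠ 0 and deg φ ≤ d/p. -/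
open Polynomial

/-- Let `p > 2` be prime, `F_q` a finite field of characteristic `p`, `d ≥ 1` coprime with
`p`, and `Q = x^d` or `x^{d+1}`. A polynomial `u` with `u(0) ≠ 0` is a `p`-th power modulo
`Q` (i.e. `u ≡ w^p (mod Q)` for some `w` coprime with `Q`) if and only if
`u ≡ φ(x^p) (mod Q)` for some `φ` with `φ(0) ≠ 0` and `deg φ ≤ d/p`. -/
theorem stmt_9 (p : ℕ) (hp : p.Prime) (hp2 : 2 < p)
    (Fq : Type*) [Field Fq] [Fintype Fq] [CharP Fq p]
    (d : ℕ) (hd : 1 ≤ d) (hdp : Nat.Coprime d p)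
    (Q : Polynomial Fq) (hQ : Q = X ^ d ∨ Q = X ^ (d + 1))
    (u : Polynomial Fq) (hu : u.eval 0 ≠ 0) :
    (∃ w : Polynomial Fq, IsCoprime w Q ∧ Q ∣ u - w ^ p) ↔
      ∃ φ : Polynomial Fq, φ.eval 0 ≠ 0 ∧ p * φ.natDegree ≤ d ∧
        Q ∣ u - φ.comp (X ^ p) := by
  have : Fact p.Prime := ⟨hp⟩
  have hppos : 0 < p := hp.pos
  have hX : X ∣ Q := by
    rcases hQ with h | h <;> rw [h]
    · exact dvd_pow_self _ (by omega)
    · exact dvd_pow_self _ (by omega)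
  have hQd : Q ∣ X ^ (d + 1) := by
    rcases hQ with h | h <;> rw [h]
    exact pow_dvd_pow _ (by omega)
  have key : ∀ f : Polynomial Fq, f ^ p = expand Fq p (f.map (frobenius Fq p)) := by
    intro f
    rw [← map_expand, map_frobenius_expand]
  have hev : ∀ v : Polynomial Fq, Q ∣ u - v → v.eval 0 ≠ 0 := by
    intro v hv h0
    obtain ⟨g, hg⟩ := hX.trans hv
    have := congrArg (eval 0) hg
    simp [h0] at this
    exact hu this
  constructor
  · rintro ⟨w, -, hw⟩
    set φ₀ := w.map (frobenius Fq p) with hφ₀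
    have hm : (X ^ (d / p + 1) : Polynomial Fq).Monic := monic_X_pow _
    have hdiv := modByMonic_add_div φ₀ (X ^ (d / p + 1) : Polynomial Fq)
    have hQφ : Q ∣ u - expand Fq p (φ₀ %ₘ X ^ (d / p + 1)) := by
      have h1 : u - expand Fq p (φ₀ %ₘ X ^ (d / p + 1)) = (u - w ^ p) +
          (X ^ p) ^ (d / p + 1) * expand Fq p (φ₀ /ₘ X ^ (d / p + 1)) := by
        rw [key w, ← hφ₀]
        have h3 := congrArg (expand Fq p) hdiv
        rw [map_add, map_mul, map_pow, expand_X] at h3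
        rw [← h3]
        ring
      rw [h1]
      refine dvd_add hw (Dvd.dvd.mul_right (hQd.trans ?_) _)
      rw [← pow_mul]
      apply pow_dvd_pow
      have := Nat.lt_mul_div_succ d hppos
      omega
    refine ⟨φ₀ %ₘ X ^ (d / p + 1), ?_, ?_, ?_⟩
    · have := hev _ hQφ
      rw [expand_eval, zero_pow hppos.ne'] at this
      exact this
    · have h2 : (φ₀ %ₘ X ^ (d / p + 1)).natDegree < d / p + 1 := by
        have := natDegree_modByMonic_lt φ₀ hm (fun h => by
          have := congrArg natDegree h
          simp at this)
        simpa using this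
      calc p * _ ≤ p * (d / p) := Nat.mul_le_mul_left _ (by omega)
        _ ≤ d := Nat.mul_div_le d p
    · rw [← expand_eq_comp_X_pow]
      exact hQφ
  · rintro ⟨φ, -, -, hφ⟩
    have hsurj : Function.Surjective (frobenius Fq p) :=
      Finite.surjective_of_injective (frobenius_inj Fq p)
    obtain ⟨w, rfl⟩ := map_surjective _ hsurj φ
    rw [← expand_eq_comp_X_pow, ← key] at hφ
    refine ⟨w, ?_, hφ⟩
    have h0 := hev _ hφ
    have hc : IsCoprime w (X : Polynomial Fq) := by
      refine IsCoprime.symm ((irreducible_X.coprime_iff_not_dvd).2 ?_)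
      rintro ⟨g, rfl⟩
      apply h0
      simp [hppos.ne']
    rcases hQ with h | h <;> rw [h] <;> exact hc.pow_right
end

section
/- There exists an absolute constant C > 0 with the following property. Let p > 2 be a prime, q a power of p, d ≥ 1 an integer coprime with p, let Q denote either x^d or x^{d+1} in F_q[x], and let N = ((F_q[x]/Q)^×)^p be the subgroup of p-th powers in (F_q[x]/Q)^×. Then for all integers r ≥ s > 0, the sum τ(r, s; N) = ∑ Λ(h)Λ(g), taken over pairs of monic polynomials h, g ∈ F_q[x] with deg h = r, deg g = s, and h·g mod Q ∈ N, satisfies τ(r, s; N) ≤ C·(r·s·q^{r+s−(1−1/p)d+1} + s^2·q^{(r+s)/p}). -/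
open Polynomial

/-- The von Mangoldt function on `F_q[x]`: `Λ(c) = deg P` if `c = P^k` for a monic
irreducible `P` and `k ≥ 1`, and `Λ(c) = 0` otherwise. -/
noncomputable def vM {F : Type*} [Field F] (c : Polynomial F) : ℕ :=
  sSup {n : ℕ | ∃ (P : Polynomial F) (k : ℕ),
    P.Monic ∧ Irreducible P ∧ 1 ≤ k ∧ c = P ^ k ∧ n = P.natDegree}


lemma vM_spec {F : Type*} [Field F] {c : F[X]} (h : vM c ≠ 0) :
    ∃ (P : F[X]) (k : ℕ), P.Monic ∧ Irreducible P ∧ 1 ≤ k ∧ c = P ^ k ∧ vM c = P.natDegree := by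
  have hne : {n : ℕ | ∃ (P : Polynomial F) (k : ℕ),
    P.Monic ∧ Irreducible P ∧ 1 ≤ k ∧ c = P ^ k ∧ n = P.natDegree}.Nonempty := by
    by_contra hc
    rw [Set.not_nonempty_iff_eq_empty] at hc
    apply h
    unfold vM
    rw [hc]
    simp
  have hb : BddAbove {n : ℕ | ∃ (P : Polynomial F) (k : ℕ),
    P.Monic ∧ Irreducible P ∧ 1 ≤ k ∧ c = P ^ k ∧ n = P.natDegree} := by
    refine ⟨c.natDegree, ?_⟩
    rintro n ⟨P, k, hP, hi, hk, rfl, rfl⟩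
    rw [natDegree_pow]
    nlinarith
  exact Nat.sSup_mem hne hb

lemma vM_le {F : Type*} [Field F] (c : F[X]) : vM c ≤ c.natDegree := by
  by_cases h : vM c = 0
  · omega
  obtain ⟨P, k, hP, hi, hk, rfl, h2⟩ := vM_spec h
  rw [h2, natDegree_pow]
  nlinarith

lemma prime_eq {F : Type*} [Field F] {P R : F[X]} (hP : P.Monic) (hPi : Irreducible P)
    (hR : R.Monic) (hRi : Irreducible R) {b : ℕ} (h : P ∣ R ^ b) : P = R :=
  eq_of_monic_of_associated hP hR
    (hPi.associated_of_dvd hRi (hPi.prime.dvd_of_dvd_pow h))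

lemma prime_sum {F : Type*} [Field F] [Fintype F] (m : ℕ) (hm : m ≠ 0) (B : Finset F[X])
    (hB : ∀ P ∈ B, P.Monic ∧ Irreducible P ∧ P.natDegree ∣ m) :
    ∑ P ∈ B, P.natDegree ≤ (Fintype.card F) ^ m := by
  have hd : ∏ P ∈ B, P ∣ (X ^ (Nat.card F) ^ m - X : F[X]) := by
    apply Finset.prod_dvd_of_coprime
    · intro P hP R hR hne
      rcases hB P hP with ⟨h1, h2, h3⟩
      rcases hB R hR with ⟨h4, h5, h6⟩
      show IsCoprime P R
      rw [h2.coprime_iff_not_dvd]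
      intro hdv
      exact hne (prime_eq h1 h2 h4 h5 (b := 1) (by simpa using hdv))
    · intro P hP
      rcases hB P hP with ⟨h1, h2, h3⟩
      exact h2.natDegree_dvd_iff_dvd_X_pow_card_pow_sub_X.mp h3
  have hq : 1 < Nat.card F := Finite.one_lt_card
  have := natDegree_le_of_dvd hd (FiniteField.X_pow_card_pow_sub_X_ne_zero F hm hq)
  rw [FiniteField.X_pow_card_pow_sub_X_natDegree_eq F hm hq,
    natDegree_prod_of_monic _ _ (fun P hP => (hB P hP).1), Nat.card_eq_fintype_card] at this
  exact this

lemma pow_det {F : Type*} [Field F] {P : F[X]} (hPi : Irreducible P) {k r : ℕ}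
    (h : (P ^ k).natDegree = r) : P ^ k = P ^ (r / P.natDegree) := by
  rw [natDegree_pow] at h
  rw [← h, Nat.mul_div_cancel _ hPi.natDegree_pos]

open Classical in
lemma fiber_card {F : Type*} [Field F] (r : ℕ) (T : Finset (F[X] × F[X]))
    (hT : ∀ x ∈ T, x.1.natDegree = r ∧ vM x.1 ≠ 0 ∧ vM x.2 ≠ 0) :
    T.card ≤ 2 * (T.image (fun x => x.1 * x.2)).card := by
  apply Finset.card_le_mul_card_image
  intro f hf
  obtain ⟨⟨h, g⟩, h0, rfl⟩ := Finset.mem_image.mp hf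
  obtain ⟨hr, hh, hg⟩ := hT _ h0
  obtain ⟨P, a, hP, hPi, ha, rfl, -⟩ := vM_spec hh
  obtain ⟨R, b, hR, hRi, hb, rfl, -⟩ := vM_spec hg
  have : (({a_1 ∈ T | a_1.1 * a_1.2 = P ^ a * R ^ b}).image Prod.fst) ⊆
      {P ^ (r / P.natDegree), R ^ (r / R.natDegree)} := by
    intro y hy
    simp only [Finset.mem_image, Finset.mem_filter] at hy
    obtain ⟨⟨h', g'⟩, ⟨h1, h2⟩, rfl⟩ := hy
    obtain ⟨hr', hh', hg'⟩ := hT _ h1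
    obtain ⟨S, c, hS, hSi, hc, rfl, -⟩ := vM_spec hh'
    simp only [Finset.mem_insert, Finset.mem_singleton]
    simp only at h2 hr'
    have hdv : S ∣ P ^ a * R ^ b := by
      rw [← h2]
      exact Dvd.dvd.mul_right (dvd_pow_self _ (by omega)) _
    rcases hSi.prime.dvd_or_dvd hdv with h3 | h3
    · obtain rfl := prime_eq hS hSi hP hPi h3
      left
      exact pow_det hSi hr'
    · obtain rfl := prime_eq hS hSi hR hRi h3
      right
      exact pow_det hSi hr'
  rw [← Finset.card_image_of_injOn (f := Prod.fst)]
  · exact (Finset.card_le_card this).trans Finset.card_le_two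
  · rintro ⟨x1, x2⟩ hx ⟨y1, y2⟩ hy hxy
    simp only [Finset.coe_filter, Set.mem_setOf_eq] at hx hy hxy
    subst hxy
    obtain ⟨-, hx', -⟩ := hT _ hx.1
    have hne : x1 ≠ 0 := by
      obtain ⟨S, c, hS, hSi, hc, h3, -⟩ := vM_spec hx'
      simp only at h3
      rw [h3]
      exact pow_ne_zero _ hSi.ne_zero
    have := mul_left_cancel₀ hne (hx.2.trans hy.2.symm)
    simp [this]

lemma coeff_pow_p {F : Type*} [Field F] (p : ℕ) (hp : p.Prime) [CharP F p] (u : F[X]) (i : ℕ)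
    (hi : ¬ p ∣ i) : (u ^ p).coeff i = 0 := by
  haveI := Fact.mk hp
  haveI : ExpChar F p := ExpChar.prime hp
  rw [← map_frobenius_expand (R := F) (p := p), coeff_map, coeff_expand hp.pos, if_neg hi, map_zero]

lemma coeff_zero_of {F : Type*} [Field F] (p : ℕ) (hp : p.Prime) [CharP F p] (d : ℕ) (Q f : F[X])
    (hQ : X ^ d ∣ Q) (w : (F[X] ⧸ Ideal.span {Q})ˣ)
    (hw : ((w ^ p : (F[X] ⧸ Ideal.span {Q})ˣ) : F[X] ⧸ Ideal.span {Q}) =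
      Ideal.Quotient.mk (Ideal.span {Q}) f) (i : ℕ) (hi : i < d) (hpi : ¬ p ∣ i) :
    f.coeff i = 0 := by
  obtain ⟨u, hu⟩ := Ideal.Quotient.mk_surjective (w : F[X] ⧸ Ideal.span {Q})
  rw [Units.val_pow_eq_pow_val, ← hu, ← map_pow, Ideal.Quotient.mk_eq_mk_iff_sub_mem,
    Ideal.mem_span_singleton] at hw
  have h1 := (X_pow_dvd_iff.mp (hQ.trans hw)) i hi
  rw [coeff_sub, coeff_pow_p p hp u i hpi] at h1
  simpa using h1

lemma eq_pow_of {F : Type*} [Field F] [Finite F] (p : ℕ) (hp : p.Prime) [CharP F p] (f : F[X])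
    (h : ∀ i, ¬ p ∣ i → f.coeff i = 0) : ∃ w : F[X], f = w ^ p := by
  haveI := Fact.mk hp
  haveI : ExpChar F p := ExpChar.prime hp
  have h1 : expand F p (contract p f) = f := by
    ext n
    rw [coeff_expand hp.pos, coeff_contract hp.ne_zero]
    split_ifs with hn
    · rw [Nat.div_mul_cancel hn]
    · exact (h n hn).symm
  obtain ⟨v, hv⟩ := Polynomial.map_surjective (frobenius F p)
    (Finite.surjective_of_injective (frobenius_inj F p)) (contract p f)
  refine ⟨v, ?_⟩
  rw [← map_frobenius_expand (R := F) (p := p), map_expand, hv, h1]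

lemma card_f {F : Type*} [Field F] [Fintype F] (p d n : ℕ) (T : Finset F[X])
    (hT : ∀ f ∈ T, f.Monic ∧ f.natDegree = n ∧ ∀ i < d, ¬ p ∣ i → f.coeff i = 0) :
    T.card ≤ Fintype.card F ^ ((Finset.range n).filter (fun i => d ≤ i ∨ p ∣ i)).card := by
  classical
  have := Finset.card_le_card_of_injOn (s := T)
    (t := (Finset.univ : Finset (((Finset.range n).filter (fun i => d ≤ i ∨ p ∣ i)) → F)))
    (fun f i => f.coeff i) (by simp) (by
      intro f hf g hg hfg
      obtain ⟨f1, f2, f3⟩ := hT f hf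
      obtain ⟨g1, g2, g3⟩ := hT g hg
      ext i
      by_cases hi : i < n
      · by_cases hd : d ≤ i ∨ p ∣ i
        · exact congrFun hfg ⟨i, by simp [hi, hd]⟩
        · push Not at hd
          rw [f3 i hd.1 hd.2, g3 i hd.1 hd.2]
      · rcases eq_or_lt_of_le (not_lt.mp hi) with h | h
        · subst h
          rw [← f2, f1.coeff_natDegree, f2, ← g2, g1.coeff_natDegree]
        · rw [coeff_eq_zero_of_natDegree_lt (by omega), coeff_eq_zero_of_natDegree_lt (by omega)])
  simpa using this

lemma idx_div (p m k : ℕ) (hk : ∀ i < m, p ∣ i → i / p < k) :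
    ((Finset.range m).filter (fun i => p ∣ i)).card ≤ k := by
  have := Finset.card_le_card_of_injOn (s := (Finset.range m).filter (fun i => p ∣ i))
    (t := Finset.range k) (fun i => i / p)
    (by
      intro i hi
      simp at hi ⊢
      exact hk i hi.1 hi.2)
    (by
      intro i hi j hj hij
      simp at hi hj hij
      rw [← Nat.div_mul_cancel hi.2, ← Nat.div_mul_cancel hj.2, hij])
  simpa using this

lemma idx_large (p d n : ℕ) (hp : 0 < p) (hd : 1 ≤ d) (hn : d ≤ n) :
    ((Finset.range n).filter (fun i => d ≤ i ∨ p ∣ i)).card ≤ (n - d) + (d / p + 1) := by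
  have h1 : (Finset.range n).filter (fun i => d ≤ i ∨ p ∣ i) ⊆
      Finset.Ico d n ∪ (Finset.range d).filter (fun i => p ∣ i) := by
    intro i hi
    simp at hi ⊢
    by_cases h : d ≤ i
    · left; omega
    · right
      exact ⟨by omega, by tauto⟩
  refine (Finset.card_le_card h1).trans ((Finset.card_union_le _ _).trans ?_)
  rw [Nat.card_Ico]
  gcongr
  apply idx_div
  intro i hi _
  have := Nat.div_le_div_right (c := p) hi.le
  omega

lemma idx_small (p d n : ℕ) (hp : 0 < p) (hn : n < d) (hpn : p ∣ n) :
    ((Finset.range n).filter (fun i => d ≤ i ∨ p ∣ i)).card ≤ n / p := by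
  have h1 : (Finset.range n).filter (fun i => d ≤ i ∨ p ∣ i) ⊆
      (Finset.range n).filter (fun i => p ∣ i) := by
    intro i hi
    simp at hi ⊢
    refine ⟨hi.1, ?_⟩
    rcases hi.2 with h | h
    · omega
    · exact h
  refine (Finset.card_le_card h1).trans ?_
  apply idx_div
  intro i hi _
  exact Nat.div_lt_div_of_lt_of_dvd hpn hi

lemma deg_dvd {F : Type*} [Field F] {P e : F[X]} {p k : ℕ} (hp : 0 < p) (hPi : Irreducible P)
    (h : Associated (e ^ p) (P ^ k)) : P.natDegree ∣ (P ^ k).natDegree / p := by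
  have h1 : e ∣ P ^ k := (dvd_pow_self e hp.ne').trans h.dvd
  obtain ⟨j, hj, hej⟩ := (dvd_prime_pow hPi.prime k).mp h1
  have h2 : (P ^ k).natDegree = p * e.natDegree := by
    rw [← natDegree_pow]
    exact (natDegree_eq_of_degree_eq (degree_eq_degree_of_associated h)).symm
  have h3 : e.natDegree = j * P.natDegree := by
    rw [← natDegree_pow]
    exact (natDegree_eq_of_degree_eq (degree_eq_degree_of_associated hej))
  rw [h2, Nat.mul_div_cancel_left _ hp, h3]
  exact dvd_mul_left _ _

lemma p_dvd_deg {F : Type*} [Field F] {h e : F[X]} {p : ℕ}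
    (he : Associated (e ^ p) h) : p ∣ h.natDegree := by
  have h2 : h.natDegree = p * e.natDegree := by
    rw [← natDegree_pow]
    exact (natDegree_eq_of_degree_eq (degree_eq_degree_of_associated he)).symm
  exact ⟨_, h2⟩

lemma diff_sum {F : Type*} [Field F] [Fintype F] (p n : ℕ) (hp : 0 < p) (hn : 0 < n)
    (A : Finset F[X]) (hA : ∀ h ∈ A, h.natDegree = n ∧ vM h ≠ 0 ∧ ∃ e, Associated (e ^ p) h) :
    ∑ h ∈ A, vM h ≤ Fintype.card F ^ (n / p) := by
  classical
  rcases A.eq_empty_or_nonempty with rfl | ⟨h0, hh0⟩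
  · simp
  have hpn : p ∣ n := by
    obtain ⟨h1, -, e, he⟩ := hA h0 hh0
    rw [← h1]
    exact p_dvd_deg he
  have hnp : n / p ≠ 0 := (Nat.div_pos (Nat.le_of_dvd hn hpn) hp).ne'
  have hc : ∀ h : F[X], ∃ P : F[X], h ∈ A → P.Monic ∧ Irreducible P ∧ h = P ^ (n / P.natDegree) ∧
      vM h = P.natDegree ∧ P.natDegree ∣ n / p := by
    intro h
    by_cases hh : h ∈ A
    · obtain ⟨h1, h2, e, he⟩ := hA h hh
      obtain ⟨P, k, hP, hPi, hk, rfl, h3⟩ := vM_spec h2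
      refine ⟨P, fun _ => ⟨hP, hPi, pow_det hPi h1, h3, ?_⟩⟩
      rw [← h1]
      exact deg_dvd hp hPi he
    · exact ⟨0, fun h => absurd h hh⟩
  choose b hb using hc
  have hinj : Set.InjOn b A := by
    intro x hx y hy hxy
    rw [(hb x hx).2.2.1, (hb y hy).2.2.1, hxy]
  calc ∑ h ∈ A, vM h = ∑ h ∈ A, (b h).natDegree :=
        Finset.sum_congr rfl fun h hh => (hb h hh).2.2.2.1
    _ = ∑ P ∈ A.image b, P.natDegree := (Finset.sum_image hinj).symm
    _ ≤ _ := by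
      apply prime_sum _ hnp
      intro P hP
      obtain ⟨h, hh, rfl⟩ := Finset.mem_image.mp hP
      obtain ⟨h1, h2, -, -, h3⟩ := hb h hh
      exact ⟨h1, h2, h3⟩

/-- The bound when `d ≤ r + s`. -/
lemma large_case {F : Type*} [Field F] [Fintype F] (p d r s : ℕ) (hp : 0 < p) (hd : 1 ≤ d)
    (hn : d ≤ r + s) (T : Finset (F[X] × F[X]))
    (hT : ∀ x ∈ T, x.1.Monic ∧ x.2.Monic ∧ x.1.natDegree = r ∧ x.2.natDegree = s ∧
      vM x.1 ≠ 0 ∧ vM x.2 ≠ 0 ∧ ∀ i < d, ¬ p ∣ i → (x.1 * x.2).coeff i = 0) :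
    ∑ x ∈ T, vM x.1 * vM x.2 ≤
      2 * (r * s * Fintype.card F ^ ((r + s - d) + (d / p + 1))) := by
  classical
  have h1 : ∑ x ∈ T, vM x.1 * vM x.2 ≤ T.card * (r * s) := by
    rw [← smul_eq_mul]
    apply Finset.sum_le_card_nsmul
    intro x hx
    obtain ⟨-, -, h3, h4, -⟩ := hT x hx
    rw [← h3, ← h4]
    exact Nat.mul_le_mul (vM_le _) (vM_le _)
  have h2 := fiber_card r T (fun x hx => by
    obtain ⟨-, -, h3, h4, h5, h6, -⟩ := hT x hx
    exact ⟨h3, h5, h6⟩)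
  have h3 := card_f p d (r + s) (T.image (fun x => x.1 * x.2)) (by
    intro f hf
    obtain ⟨x, hx, rfl⟩ := Finset.mem_image.mp hf
    obtain ⟨h1, h2, h3, h4, h5, h6, h7⟩ := hT x hx
    exact ⟨h1.mul h2, by rw [h1.natDegree_mul h2, h3, h4], h7⟩)
  have h4 : Fintype.card F ^ ((Finset.range (r + s)).filter (fun i => d ≤ i ∨ p ∣ i)).card ≤
      Fintype.card F ^ ((r + s - d) + (d / p + 1)) :=
    Nat.pow_le_pow_right Fintype.card_pos (idx_large p d (r + s) hp hd hn)
  calc _ ≤ T.card * (r * s) := h1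
    _ ≤ (2 * Fintype.card F ^ ((r + s - d) + (d / p + 1))) * (r * s) := by
      gcongr
      exact h2.trans (by gcongr; exact h3.trans h4)
    _ = _ := by ring

/-- The bound when `r + s < d`. -/
lemma small_case {F : Type*} [Field F] [Fintype F] (p d r s : ℕ) (hp : p.Prime) [CharP F p]
    (hs : 0 < s) (hsr : s ≤ r)
    (hn : r + s < d) (T : Finset (F[X] × F[X]))
    (hT : ∀ x ∈ T, x.1.Monic ∧ x.2.Monic ∧ x.1.natDegree = r ∧ x.2.natDegree = s ∧
      vM x.1 ≠ 0 ∧ vM x.2 ≠ 0 ∧ ∀ i < d, ¬ p ∣ i → (x.1 * x.2).coeff i = 0) :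
    ∑ x ∈ T, vM x.1 * vM x.2 ≤
      3 * (s ^ 2 * Fintype.card F ^ ((r + s) / p)) := by
  classical
  have hpow : ∀ x ∈ T, ∃ w, x.1 * x.2 = w ^ p := by
    intro x hx
    obtain ⟨h1, h2, h3, h4, h5, h6, h7⟩ := hT x hx
    apply eq_pow_of p hp
    intro i hi
    by_cases hid : i < d
    · exact h7 i hid hi
    · apply coeff_eq_zero_of_natDegree_lt
      rw [h1.natDegree_mul h2, h3, h4]
      omega
  rcases T.eq_empty_or_nonempty with rfl | ⟨x0, hx0⟩
  · simp
  have hpn : p ∣ r + s := by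
    obtain ⟨w, hw⟩ := hpow x0 hx0
    obtain ⟨h1, h2, h3, h4, -⟩ := hT x0 hx0
    have := congrArg natDegree hw
    rw [h1.natDegree_mul h2, h3, h4, natDegree_pow] at this
    exact ⟨_, this⟩
  rw [← Finset.sum_filter_add_sum_filter_not T (fun x => IsCoprime x.1 x.2)]
  have hdiff : ∑ x ∈ T.filter (fun x => IsCoprime x.1 x.2), vM x.1 * vM x.2 ≤
      Fintype.card F ^ ((r + s) / p) := by
    have key : ∀ x ∈ T.filter (fun x => IsCoprime x.1 x.2),
        (∃ e, Associated (e ^ p) x.1) ∧ (∃ e, Associated (e ^ p) x.2) := by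
      intro x hx
      rw [Finset.mem_filter] at hx
      obtain ⟨w, hw⟩ := hpow x hx.1
      exact ⟨exists_associated_pow_of_mul_eq_pow' hx.2 hw,
        exists_associated_pow_of_mul_eq_pow' hx.2.symm ((mul_comm _ _).trans hw)⟩
    set A := (T.filter (fun x => IsCoprime x.1 x.2)).image Prod.fst with hA
    set B := (T.filter (fun x => IsCoprime x.1 x.2)).image Prod.snd with hB
    have hAs := diff_sum p r hp.pos (by omega) A (by
      intro h hh
      obtain ⟨x, hx, rfl⟩ := Finset.mem_image.mp hh
      obtain ⟨h1, h2, h3, h4, h5, h6, h7⟩ := hT x (Finset.mem_filter.mp hx).1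
      exact ⟨h3, h5, (key x hx).1⟩)
    have hBs := diff_sum p s hp.pos hs B (by
      intro h hh
      obtain ⟨x, hx, rfl⟩ := Finset.mem_image.mp hh
      obtain ⟨h1, h2, h3, h4, h5, h6, h7⟩ := hT x (Finset.mem_filter.mp hx).1
      exact ⟨h4, h6, (key x hx).2⟩)
    calc _ ≤ ∑ x ∈ A ×ˢ B, vM x.1 * vM x.2 := by
          apply Finset.sum_le_sum_of_subset
          intro x hx
          rw [Finset.mem_product]
          exact ⟨Finset.mem_image_of_mem _ hx, Finset.mem_image_of_mem _ hx⟩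
      _ = (∑ h ∈ A, vM h) * ∑ g ∈ B, vM g := by
          rw [Finset.sum_product, Finset.sum_mul_sum]
      _ ≤ Fintype.card F ^ (r / p) * Fintype.card F ^ (s / p) := Nat.mul_le_mul hAs hBs
      _ = Fintype.card F ^ (r / p + s / p) := (pow_add _ _ _).symm
      _ ≤ _ := Nat.pow_le_pow_right Fintype.card_pos (Nat.add_div_le_add_div _ _ _)
  have hsame : ∑ x ∈ T.filter (fun x => ¬ IsCoprime x.1 x.2), vM x.1 * vM x.2 ≤
      2 * (s ^ 2 * Fintype.card F ^ ((r + s) / p)) := by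
    set U := T.filter (fun x => ¬ IsCoprime x.1 x.2) with hU
    have hUT : ∀ x ∈ U, x ∈ T := fun x hx => (Finset.mem_filter.mp hx).1
    have h1 : ∑ x ∈ U, vM x.1 * vM x.2 ≤ U.card * (s ^ 2) := by
      rw [← smul_eq_mul]
      apply Finset.sum_le_card_nsmul
      intro x hx
      obtain ⟨-, -, h3, h4, h5, h6, -⟩ := hT x (hUT x hx)
      have hnc := (Finset.mem_filter.mp hx).2
      obtain ⟨P, a, hP, hPi, ha, hPa, hPv⟩ := vM_spec h5
      obtain ⟨R, b, hR, hRi, hb, hRb, hRv⟩ := vM_spec h6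
      have hPR : P = R := by
        by_contra hne
        apply hnc
        rw [hPa, hRb]
        apply IsCoprime.pow
        rw [hPi.coprime_iff_not_dvd]
        intro hdv
        exact hne (prime_eq hP hPi hR hRi (b := 1) (by simpa using hdv))
      have h8 : vM x.1 = vM x.2 := by rw [hPv, hRv, hPR]
      have h9 : vM x.2 ≤ s := h4 ▸ vM_le x.2
      rw [h8, sq]
      exact Nat.mul_le_mul h9 h9
    have h2 := fiber_card r U (fun x hx => by
      obtain ⟨-, -, h3, h4, h5, h6, -⟩ := hT x (hUT x hx)
      exact ⟨h3, h5, h6⟩)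
    have h3 := card_f p d (r + s) (U.image (fun x => x.1 * x.2)) (by
      intro f hf
      obtain ⟨x, hx, rfl⟩ := Finset.mem_image.mp hf
      obtain ⟨h1, h2, h3, h4, h5, h6, h7⟩ := hT x (hUT x hx)
      exact ⟨h1.mul h2, by rw [h1.natDegree_mul h2, h3, h4], h7⟩)
    have h4 : Fintype.card F ^ ((Finset.range (r + s)).filter (fun i => d ≤ i ∨ p ∣ i)).card ≤
        Fintype.card F ^ ((r + s) / p) :=
      Nat.pow_le_pow_right Fintype.card_pos (idx_small p d (r + s) hp.pos hn hpn)
    calc _ ≤ U.card * (s ^ 2) := h1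
      _ ≤ (2 * Fintype.card F ^ ((r + s) / p)) * (s ^ 2) := by
        gcongr
        exact h2.trans (by gcongr; exact h3.trans h4)
      _ = _ := by ring
  have hs2 : Fintype.card F ^ ((r + s) / p) ≤ s ^ 2 * Fintype.card F ^ ((r + s) / p) :=
    Nat.le_mul_of_pos_left _ (by positivity)
  omega

/-- There is an absolute constant `C > 0` such that for every prime `p > 2`, every finite
field `F_q` of characteristic `p`, every `d ≥ 1` coprime with `p`, `Q = x^d` or `x^{d+1}`,
and all integers `r ≥ s > 0`, the sum
`τ(r, s; N) = ∑_{deg h = r, deg g = s monic, h·g mod Q ∈ N} Λ(h)Λ(g)`,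
where `N = ((F_q[x]/Q)ˣ)^p`, satisfies
`τ(r,s;N) ≤ C·(r·s·q^{r+s−(1−1/p)d+1} + s²·q^{(r+s)/p})`. -/
theorem stmt_12 : ∃ C : ℝ, 0 < C ∧
    ∀ (p : ℕ), p.Prime → 2 < p →
    ∀ (Fq : Type) [Field Fq] [Fintype Fq], CharP Fq p →
    ∀ (d : ℕ), 1 ≤ d → Nat.Coprime d p →
    ∀ Q : Polynomial Fq, (Q = X ^ d ∨ Q = X ^ (d + 1)) →
    ∀ r s : ℕ, 0 < s → s ≤ r →
      ((∑ᶠ hg ∈ {hg : Polynomial Fq × Polynomial Fq |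
            hg.1.Monic ∧ hg.2.Monic ∧ hg.1.natDegree = r ∧ hg.2.natDegree = s ∧
            ∃ w : (Polynomial Fq ⧸ Ideal.span {Q})ˣ,
              ((w ^ p : (Polynomial Fq ⧸ Ideal.span {Q})ˣ) : Polynomial Fq ⧸ Ideal.span {Q}) =
                Ideal.Quotient.mk (Ideal.span {Q}) (hg.1 * hg.2)},
          (vM hg.1 * vM hg.2 : ℕ) : ℕ) : ℝ) ≤
        C * ((r : ℝ) * (s : ℝ) * (Fintype.card Fq : ℝ) ^
            ((r : ℝ) + (s : ℝ) - (1 - 1 / (p : ℝ)) * (d : ℝ) + 1) +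
          (s : ℝ) ^ 2 * (Fintype.card Fq : ℝ) ^ (((r : ℝ) + (s : ℝ)) / (p : ℝ))) := by
  refine ⟨3, by norm_num, ?_⟩
  intro p hp hp2 Fq _ _ hchar d hd hdp Q hQ r s hs hsr
  have hQd : X ^ d ∣ Q := by
    rcases hQ with rfl | rfl
    · exact dvd_rfl
    · exact pow_dvd_pow _ (by omega)
  have hq1 : (1 : ℝ) ≤ (Fintype.card Fq : ℝ) := by exact_mod_cast Fintype.card_pos
  have hq0 : (0 : ℝ) < (Fintype.card Fq : ℝ) := by linarith
  have hpR : (0 : ℝ) < p := by exact_mod_cast hp.pos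
  set S := {hg : Polynomial Fq × Polynomial Fq |
            hg.1.Monic ∧ hg.2.Monic ∧ hg.1.natDegree = r ∧ hg.2.natDegree = s ∧
            ∃ w : (Polynomial Fq ⧸ Ideal.span {Q})ˣ,
              ((w ^ p : (Polynomial Fq ⧸ Ideal.span {Q})ˣ) : Polynomial Fq ⧸ Ideal.span {Q}) =
                Ideal.Quotient.mk (Ideal.span {Q}) (hg.1 * hg.2)} with hS
  by_cases hfin : (S ∩ Function.support (fun hg : Fq[X] × Fq[X] => vM hg.1 * vM hg.2)).Finite
  swap
  · rw [finsum_mem_eq_zero_of_infinite hfin, Nat.cast_zero]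
    positivity
  rw [finsum_mem_eq_sum _ hfin]
  have hT : ∀ x ∈ hfin.toFinset, x.1.Monic ∧ x.2.Monic ∧ x.1.natDegree = r ∧ x.2.natDegree = s ∧
      vM x.1 ≠ 0 ∧ vM x.2 ≠ 0 ∧ ∀ i < d, ¬ p ∣ i → (x.1 * x.2).coeff i = 0 := by
    intro x hx
    rw [Set.Finite.mem_toFinset] at hx
    obtain ⟨⟨h1, h2, h3, h4, w, hw⟩, h5⟩ := hx
    have h5' : vM x.1 * vM x.2 ≠ 0 := h5
    exact ⟨h1, h2, h3, h4, left_ne_zero_of_mul h5', right_ne_zero_of_mul h5',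
      fun i hi hpi => coeff_zero_of p hp d Q _ hQd w hw i hi hpi⟩
  by_cases hn : d ≤ r + s
  · have h := large_case p d r s hp.pos hd hn hfin.toFinset hT
    have hexp : (Fintype.card Fq : ℝ) ^ ((r + s - d) + (d / p + 1)) ≤
        (Fintype.card Fq : ℝ) ^ ((r : ℝ) + (s : ℝ) - (1 - 1 / (p : ℝ)) * (d : ℝ) + 1) := by
      rw [← Real.rpow_natCast]
      apply Real.rpow_le_rpow_of_exponent_le hq1
      have : ((d / p : ℕ) : ℝ) ≤ (d : ℝ) / p := Nat.cast_div_le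
      push_cast [Nat.cast_sub hn]
      have e : (1 - 1 / (p : ℝ)) * (d : ℝ) = d - d / p := by ring
      rw [e]
      linarith
    have hR : ((∑ x ∈ hfin.toFinset, vM x.1 * vM x.2 : ℕ) : ℝ) ≤
        2 * ((r : ℝ) * s * (Fintype.card Fq : ℝ) ^ ((r + s - d) + (d / p + 1))) := by
      exact_mod_cast h
    have h2 : (r : ℝ) * s * (Fintype.card Fq : ℝ) ^ ((r + s - d) + (d / p + 1)) ≤
      (r : ℝ) * s *
        (Fintype.card Fq : ℝ) ^ ((r : ℝ) + (s : ℝ) - (1 - 1 / (p : ℝ)) * (d : ℝ) + 1) := by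
      gcongr
    have h3 : 0 ≤ (s : ℝ) ^ 2 * (Fintype.card Fq : ℝ) ^ (((r : ℝ) + (s : ℝ)) / (p : ℝ)) := by
      positivity
    have h4 : 0 ≤ (r : ℝ) * s * (Fintype.card Fq : ℝ) ^ ((r + s - d) + (d / p + 1)) := by
      positivity
    refine hR.trans ?_
    linarith
  · have h := small_case p d r s hp hs hsr (by omega) hfin.toFinset hT
    have hexp : (Fintype.card Fq : ℝ) ^ ((r + s) / p) ≤
        (Fintype.card Fq : ℝ) ^ (((r : ℝ) + (s : ℝ)) / (p : ℝ)) := by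
      rw [← Real.rpow_natCast]
      apply Real.rpow_le_rpow_of_exponent_le hq1
      have : (((r + s) / p : ℕ) : ℝ) ≤ ((r + s : ℕ) : ℝ) / p := Nat.cast_div_le
      rwa [Nat.cast_add] at this
    have hR : ((∑ x ∈ hfin.toFinset, vM x.1 * vM x.2 : ℕ) : ℝ) ≤
        3 * ((s : ℝ) ^ 2 * (Fintype.card Fq : ℝ) ^ ((r + s) / p)) := by
      exact_mod_cast h
    have h2 : (s : ℝ) ^ 2 * (Fintype.card Fq : ℝ) ^ ((r + s) / p) ≤
        (s : ℝ) ^ 2 * (Fintype.card Fq : ℝ) ^ (((r : ℝ) + (s : ℝ)) / (p : ℝ)) := by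
      gcongr
    have h3 : 0 ≤ (r : ℝ) * s *
        (Fintype.card Fq : ℝ) ^ ((r : ℝ) + (s : ℝ) - (1 - 1 / (p : ℝ)) * (d : ℝ) + 1) := by
      positivity
    refine hR.trans ?_
    linarith
end

section
/- There exists an absolute constant C > 0 with the following property. Let p > 2 be a prime, q a power of p, and let d ≥ 1 be an odd integer coprime with p. Let Q denote either x^d or x^{d+1} in F_q[x]. Let A ⊆ (F_q[x]/Q)^× be the subgroup of residues of polynomials u with u(0) ≠ 0 that are congruent modulo Q to a polynomial in F_q[x^2], and let B ⊆ (F_q[x]/Q)^× be the subgroup of residues of polynomials u with u(0) ≠ 0 that are congruent modulo Q to a polynomial in F_q[x^p]. Then for every integer r ≥ 1, |ψ(r; AB) − ψ(r; A)| ≤ C·(r·q^{r−(1−1/p)d/2+3} + r·q^{r/p+3ω}), where ω = 1 if r > d/4 − 1 and ω = 0 otherwise. -/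
open Polynomial



/-- parity of degrees -/
lemma par_deg {F : Type*} [Field F] (h2 : (2 : F) ≠ 0) {c e : F[X]} (hc : c ≠ 0) (he : e ≠ 0)
    (h : c * e.comp (-X) = c.comp (-X) * e) : Even (c.natDegree + e.natDegree) := by
  have hl := congrArg leadingCoeff h
  have hX : (-X : F[X]).natDegree ≠ 0 := by simp
  rw [leadingCoeff_mul, leadingCoeff_mul, leadingCoeff_comp hX, leadingCoeff_comp hX] at hl
  by_contra hodd
  rw [Nat.not_even_iff_odd] at hodd
  have h1 : c.leadingCoeff ≠ 0 := leadingCoeff_ne_zero.mpr hc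
  have h3 : e.leadingCoeff ≠ 0 := leadingCoeff_ne_zero.mpr he
  simp only [leadingCoeff_neg, leadingCoeff_X] at hl
  rcases Nat.even_or_odd c.natDegree with hp | hp
  · have hq : Odd e.natDegree := by grind
    rw [hp.neg_one_pow, hq.neg_one_pow] at hl
    apply mul_ne_zero (mul_ne_zero h2 h1) h3
    linear_combination -hl
  · have hq : Even e.natDegree := by grind
    rw [hp.neg_one_pow, hq.neg_one_pow] at hl
    apply mul_ne_zero (mul_ne_zero h2 h1) h3
    linear_combination hl

lemma natDegree_neg_comp {F : Type*} [Field F] (c : F[X]) : (c.comp (-X)).natDegree = c.natDegree := by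
  rw [natDegree_comp]; simp

/-- the lattice attached to `G` -/
def InL {F : Type*} [Field F] (d : ℕ) (G c : F[X]) : Prop :=
  X ^ d ∣ (c - c.comp (-X)) - (c + c.comp (-X)) * G

lemma InL.sub {F : Type*} [Field F] {d : ℕ} {G c e : F[X]} (hc : InL d G c) (he : InL d G e) :
    InL d G (c - e) := by
  unfold InL at *
  have := dvd_sub hc he
  convert this using 1
  simp only [sub_comp]
  ring

lemma InL.det {F : Type*} [Field F] (h2 : (2 : F) ≠ 0) {d : ℕ} {G c e : F[X]}
    (hc : InL d G c) (he : InL d G e) :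
    X ^ d ∣ c * e.comp (-X) - c.comp (-X) * e := by
  unfold InL at *
  have h := dvd_sub (hc.mul_right (e + e.comp (-X))) (he.mul_right (c + c.comp (-X)))
  have h3 := h.mul_left (C (2⁻¹ : F))
  convert h3 using 1
  have h4 : C (2⁻¹ : F) * 2 = 1 := by
    rw [show (2 : F[X]) = C 2 from rfl, ← C_mul, inv_mul_cancel₀ h2, C_1]
  linear_combination -(c * e.comp (-X) - c.comp (-X) * e) * h4

lemma InL.parallel {F : Type*} [Field F] (h2 : (2 : F) ≠ 0) {d : ℕ} {G c e : F[X]}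
    (hc : InL d G c) (he : InL d G e) (hd : c.natDegree + e.natDegree < d) :
    c * e.comp (-X) = c.comp (-X) * e := by
  have h := hc.det h2 he
  rw [← sub_eq_zero]
  by_contra hne
  have := natDegree_le_of_dvd h hne
  rw [natDegree_X_pow] at this
  have h5 : (c * e.comp (-X) - c.comp (-X) * e).natDegree ≤ c.natDegree + e.natDegree := by
    refine (natDegree_sub_le _ _).trans (max_le ?_ ?_) <;>
    · refine natDegree_mul_le.trans ?_
      rw [natDegree_neg_comp]
  omega

/-- counting a lattice through its set of degrees -/
lemma card_by_degrees {F : Type*} [Field F] [Fintype F] (V : Set F[X])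
    (hV : ∀ c ∈ V, ∀ e ∈ V, c - e ∈ V) (D : Finset ℕ)
    (hD : ∀ c ∈ V, c ≠ 0 → c.natDegree ∈ D) :
    V.ncard ≤ Fintype.card F ^ D.card := by
  classical
  have := Set.ncard_le_ncard_of_injOn (s := V) (t := (Set.univ : Set (D → F)))
    (fun c j => c.coeff j) (fun _ _ => Set.mem_univ _) (by
      intro c hc e he hce
      by_contra hne
      have hm := hD _ (hV c hc e he) (sub_ne_zero.mpr hne)
      have := congrFun hce ⟨_, hm⟩
      simp only at this
      have h0 : (c - e).leadingCoeff = 0 := by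
        rw [leadingCoeff, coeff_sub, this, sub_self]
      exact sub_ne_zero.mpr hne (leadingCoeff_eq_zero.mp h0)) Set.finite_univ
  simpa [Set.ncard_univ, Nat.card_eq_fintype_card] using this

lemma pairing (D : Finset ℕ) (d r : ℕ) (hd : Odd d) (hne : D.Nonempty)
    (hr : ∀ i ∈ D, i ≤ r) (hl : ∀ i ∈ D, d ≤ i + r + 2)
    (hp : ∀ i ∈ D, ∀ j ∈ D, i + j < d → Even (i + j)) :
    2 * D.card + d ≤ 2 * r + 3 := by
  classical
  let f : ℕ ↪ ℤ := ⟨fun i => (i : ℤ), fun _ _ h => by simpa using h⟩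
  let g : ℕ ↪ ℤ := ⟨fun i => (d : ℤ) - 2 - i, fun _ _ h => by simpa using h⟩
  have hf : ∀ i, f i = (i : ℤ) := fun _ => rfl
  have hg : ∀ i, g i = (d : ℤ) - 2 - i := fun _ => rfl
  have hdis : Disjoint (D.map f) (D.map g) := by
    rw [Finset.disjoint_left]
    rintro x hx hy
    simp only [Finset.mem_map, hf, hg] at hx hy
    obtain ⟨i, hi, rfl⟩ := hx
    obtain ⟨j, hj, hij⟩ := hy
    have := hp i hi j hj (by omega)
    obtain ⟨k, hk⟩ := this
    obtain ⟨m, hm⟩ := hd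
    omega
  have hsub : D.map f ∪ D.map g ⊆ Finset.Icc ((d : ℤ) - 2 - r) r := by
    intro x hx
    simp only [Finset.mem_union, Finset.mem_map, hf, hg] at hx
    rw [Finset.mem_Icc]
    rcases hx with ⟨i, hi, rfl⟩ | ⟨i, hi, rfl⟩ <;> have := hr i hi <;> have := hl i hi <;> omega
  have hc := Finset.card_le_card hsub
  rw [Finset.card_union_of_disjoint hdis, Finset.card_map, Finset.card_map, Int.card_Icc] at hc
  have := hne.card_pos
  omega

open Classical in
/-- number of lattice points, when there is no very short vector -/
lemma card_good_s13 {F : Type*} [Field F] [Fintype F] (h2 : (2 : F) ≠ 0) (d r : ℕ) (hd : Odd d)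
    (hr : 1 ≤ r) (G : F[X])
    (hgood : ∀ c, c ≠ 0 → InL d G c → d ≤ c.natDegree + r + 2) :
    (({c : F[X] | c.natDegree = r ∧ InL d G c}.ncard : ℕ) : ℝ) ≤
      (Fintype.card F : ℝ) ^ ((r : ℝ) - d / 2 + 3 / 2) := by
  set T := {c : F[X] | c.natDegree = r ∧ InL d G c} with hT
  have hq : (1 : ℝ) ≤ Fintype.card F := by exact_mod_cast Fintype.card_pos
  rcases T.eq_empty_or_nonempty with h0 | ⟨c0, hc0, hc0'⟩
  · rw [h0]; simp; positivity
  set V := {c : F[X] | c.natDegree ≤ r ∧ InL d G c} with hVd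
  set D := (Finset.range (r + 1)).filter (fun i => ∃ c ∈ V, c ≠ 0 ∧ c.natDegree = i) with hDd
  have hcard := card_by_degrees V (by
    rintro c ⟨hc, hc'⟩ e ⟨he, he'⟩
    exact ⟨(natDegree_sub_le _ _).trans (max_le hc he), hc'.sub he'⟩) D (by
    intro c hc hne
    simp only [hDd, Finset.mem_filter, Finset.mem_range]
    exact ⟨Nat.lt_succ_of_le hc.1, c, hc, hne, rfl⟩)
  have hfin : V.Finite := by
    have hinj : Set.InjOn (fun (c : F[X]) (j : Fin (r + 1)) => c.coeff j) V := by
      rintro c ⟨hc, -⟩ e ⟨he, -⟩ hce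
      ext n
      by_cases hn : n < r + 1
      · exact congrFun hce ⟨n, hn⟩
      · rw [coeff_eq_zero_of_natDegree_lt (by omega), coeff_eq_zero_of_natDegree_lt (by omega)]
    exact Set.Finite.of_finite_image (Set.toFinite _) hinj
  have hTV : T.ncard ≤ V.ncard := Set.ncard_le_ncard (fun c hc => ⟨hc.1.le, hc.2⟩) hfin
  have hcne : c0 ≠ 0 := by rintro rfl; simp at hc0; omega
  have hpair := pairing D d r hd
    ⟨r, by
      simp only [hDd, Finset.mem_filter, Finset.mem_range]
      exact ⟨by omega, c0, ⟨hc0.le, hc0'⟩, hcne, hc0⟩⟩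
    (by intro i hi; simp only [hDd, Finset.mem_filter, Finset.mem_range] at hi; omega)
    (by
      intro i hi; simp only [hDd, Finset.mem_filter, Finset.mem_range] at hi
      obtain ⟨-, c, hc, hne, rfl⟩ := hi
      exact hgood c hne hc.2)
    (by
      intro i hi j hj hij
      simp only [hDd, Finset.mem_filter, Finset.mem_range] at hi hj
      obtain ⟨-, c, hc, hne, rfl⟩ := hi
      obtain ⟨-, e, he, hne', rfl⟩ := hj
      exact par_deg h2 hne hne' (hc.2.parallel h2 he.2 hij))
  calc (T.ncard : ℝ) ≤ ((Fintype.card F ^ D.card : ℕ) : ℝ) := by exact_mod_cast hTV.trans hcard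
    _ = (Fintype.card F : ℝ) ^ ((D.card : ℕ) : ℝ) := by rw [Real.rpow_natCast]; push_cast; rfl
    _ ≤ _ := by
      apply Real.rpow_le_rpow_of_exponent_le hq
      have : (2 * D.card + d : ℝ) ≤ 2 * r + 3 := by exact_mod_cast hpair
      linarith

lemma InL.wronskian {F : Type*} [Field F] (h2 : (2 : F) ≠ 0) {d : ℕ} {G e : F[X]}
    (hG : derivative G = 0) (he : InL d G e) (hd : 2 * e.natDegree + 1 < d) :
    derivative e * e.comp (-X) - e * derivative (e.comp (-X)) = 0 := by
  set f := e.comp (-X) with hf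
  have hfd : f.natDegree = e.natDegree := natDegree_neg_comp e
  have h1 : X ^ (d - 1) ∣ (e - f) - (e + f) * G := (pow_dvd_pow X (by omega)).trans he
  have h3 : X ^ (d - 1) ∣ derivative ((e - f) - (e + f) * G) := by
    obtain ⟨w, hw⟩ := he
    rw [← hf] at hw
    rw [hw, derivative_mul, derivative_X_pow]
    exact dvd_add (((dvd_mul_left _ _)).mul_right _) ((pow_dvd_pow X (by omega)).mul_right _)
  have h4 := dvd_sub (h3.mul_right (e + f)) (h1.mul_right (derivative (e + f)))
  have h5 := h4.mul_left (C (2⁻¹ : F))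
  have h6 : C (2⁻¹ : F) * 2 = 1 := by
    rw [show (2 : F[X]) = C 2 from rfl, ← C_mul, inv_mul_cancel₀ h2, C_1]
  have h7 : X ^ (d - 1) ∣ derivative e * f - e * derivative f := by
    convert h5 using 1
    simp only [derivative_sub, derivative_mul, derivative_add, hG]
    linear_combination -(derivative e * f - e * derivative f) * h6
  by_contra hne
  have h8 := natDegree_le_of_dvd h7 hne
  rw [natDegree_X_pow] at h8
  have h9 : (derivative e * f - e * derivative f).natDegree ≤ 2 * e.natDegree := by
    have := natDegree_derivative_le e
    have := natDegree_derivative_le f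
    refine (natDegree_sub_le _ _).trans (max_le ?_ ?_) <;>
    · refine natDegree_mul_le.trans ?_
      omega
  omega

lemma wronskian_transfer {F : Type*} [Field F] {c e : F[X]} (he : e ≠ 0)
    (hpar : c * e.comp (-X) = c.comp (-X) * e)
    (hW : derivative e * e.comp (-X) - e * derivative (e.comp (-X)) = 0) :
    derivative c * c.comp (-X) - c * derivative (c.comp (-X)) = 0 := by
  set f := e.comp (-X)
  set g := c.comp (-X)
  have h' := congrArg derivative hpar
  simp only [derivative_mul] at h'
  have : e ^ 2 * (derivative c * g - c * derivative g) = 0 := by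
    linear_combination c ^ 2 * hW - (e * derivative c + c * derivative e) * hpar + (e * c) * h'
  exact (mul_eq_zero.mp this).resolve_left (pow_ne_zero 2 he)

lemma prime_power_case {F : Type*} [Field F] {c P : F[X]} {k : ℕ} (hP : Irreducible P)
    (hc : c = P ^ k) (h0 : c.eval 0 ≠ 0) (hne : c.comp (-X) ≠ c)
    (hW : derivative c * c.comp (-X) - c * derivative (c.comp (-X)) = 0) :
    derivative c = 0 := by
  have hc0 : c ≠ 0 := by rintro rfl; simp at h0
  have hcomp : c.comp (-X) = (P.comp (-X)) ^ k := by rw [hc, pow_comp]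
  by_cases hdvd : P ∣ P.comp (-X)
  · exfalso
    have h1 : c ∣ c.comp (-X) := by rw [hcomp, hc]; exact pow_dvd_pow_of_dvd hdvd k
    obtain ⟨w, hw⟩ := h1
    have hw0 : w ≠ 0 := by
      rintro rfl
      rw [mul_zero, comp_neg_X_eq_zero_iff] at hw
      exact hc0 hw
    have hdeg := congrArg natDegree hw
    rw [natDegree_neg_comp, natDegree_mul hc0 hw0] at hdeg
    obtain ⟨a, rfl⟩ := natDegree_eq_zero.mp (show w.natDegree = 0 by omega)
    have hev := congrArg (eval 0) hw
    simp only [eval_comp, eval_mul, eval_C, eval_neg, eval_X, neg_zero] at hev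
    have ha : a = 1 := by
      apply mul_left_cancel₀ h0
      rw [← hev, mul_one]
    apply hne
    rw [hw, ha, C_1, mul_one]
  · have hco : IsCoprime c (c.comp (-X)) := by
      rw [hcomp]
      nth_rewrite 1 [hc]
      exact ((Irreducible.coprime_iff_not_dvd hP).mpr hdvd).pow
    rw [← dvd_derivative_iff]
    apply hco.dvd_of_dvd_mul_right
    rw [sub_eq_zero.mp hW]
    exact dvd_mul_right _ _

lemma short_case {F : Type*} [Field F] (h2 : (2 : F) ≠ 0) {d : ℕ} {G c e P : F[X]} {k : ℕ}
    (hG : derivative G = 0) (hP : Irreducible P)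
    (hc : c = P ^ k) (h0 : c.eval 0 ≠ 0) (hne : c.comp (-X) ≠ c) (hcL : InL d G c)
    (he : e ≠ 0) (heL : InL d G e) (hd : e.natDegree + c.natDegree + 2 < d) :
    derivative c = 0 := by
  apply prime_power_case hP hc h0 hne
  by_cases hle : e.natDegree ≤ c.natDegree
  · exact wronskian_transfer he (hcL.parallel h2 heL (by omega))
      (heL.wronskian h2 hG (by omega))
  · exact hcL.wronskian h2 hG (by omega)

lemma coeff_comp_neg_X' {F : Type*} [Field F] (f : F[X]) (n : ℕ) :
    (f.comp (-X)).coeff n = (-1) ^ n * f.coeff n := by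
  have : (-X : F[X]) = C (-1) * X := by simp
  rw [this, comp_C_mul_X_coeff, mul_comm]

/-- the odd polynomial in `x^p` with given coefficients -/
noncomputable def Gh {F : Type*} [Field F] (M : ℕ) (h : Fin M → F) : F[X] :=
  ∑ i : Fin M, C (h i) * X ^ (2 * (i : ℕ) + 1)

lemma exists_G {F : Type*} [Field F] (h2 : (2 : F) ≠ 0) {p d N : ℕ} (hp : Odd p)
    (hN : d ≤ p * N) {a b c : F[X]} (hb : b.eval 0 ≠ 0)
    (hc : X ^ d ∣ c - a.comp (X ^ 2) * b.comp (X ^ p)) :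
    ∃ h : Fin (N / 2) → F, InL d ((Gh (N / 2) h).comp (X ^ p)) c := by
  set b' := b.comp (-X) with hb'
  have hc' : X ^ d ∣ c.comp (-X) - a.comp (X ^ 2) * b'.comp (X ^ p) := by
    obtain ⟨w, hw⟩ := hc
    refine ⟨(-1) ^ d * w.comp (-X), ?_⟩
    have := congrArg (fun f => f.comp (-X)) hw
    simp only [sub_comp, mul_comp, comp_assoc, X_pow_comp] at this
    rw [neg_sq, hp.neg_pow, neg_pow (X : F[X]) d] at this
    rw [hb', comp_assoc, neg_comp, X_comp, this]
    ring
  have hcop : IsCoprime (b + b') (X ^ N) := by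
    apply IsCoprime.pow_right
    apply IsCoprime.symm
    rw [Irreducible.coprime_iff_not_dvd irreducible_X, X_dvd_iff, coeff_zero_eq_eval_zero]
    simp only [hb', eval_add, eval_comp, eval_neg, eval_X, neg_zero]
    rw [← two_mul]
    exact mul_ne_zero h2 hb
  obtain ⟨u, v, huv⟩ := hcop
  have hb'' : b'.comp (-X) = b := comp_neg_X_comp_neg_X b
  have h6 : C (2⁻¹ : F) * 2 = 1 := by
    rw [show (2 : F[X]) = C 2 from rfl, ← C_mul, inv_mul_cancel₀ h2, C_1]
  have huv' : u.comp (-X) * (b + b') + v.comp (-X) * (-1) ^ N * X ^ N = 1 := by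
    have := congrArg (fun f => f.comp (-X)) huv
    simp only [add_comp, mul_comp, X_pow_comp, one_comp, hb''] at this
    rw [← hb', neg_pow (X : F[X]) N] at this
    linear_combination this
  set g := C (2⁻¹ : F) * (u + u.comp (-X)) * (b - b') with hg
  have hgodd : g.comp (-X) = -g := by
    simp only [hg, mul_comp, add_comp, sub_comp, C_comp, comp_neg_X_comp_neg_X, hb'']
    rw [← hb']
    ring
  have hgdvd : X ^ N ∣ (b - b') - (b + b') * g := by
    refine ⟨C (2⁻¹ : F) * (v + v.comp (-X) * (-1) ^ N) * (b - b'), ?_⟩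
    rw [hg]
    linear_combination (-(b - b')) * h6 - C (2⁻¹ : F) * (b - b') * (huv + huv')
  set h : Fin (N / 2) → F := fun i => g.coeff (2 * (i : ℕ) + 1) with hh
  have htr : X ^ N ∣ g - Gh (N / 2) h := by
    rw [X_pow_dvd_iff]
    intro k hk
    rw [coeff_sub, Gh, finsetSum_coeff]
    simp only [coeff_C_mul_X_pow]
    rcases Nat.even_or_odd' k with ⟨m, rfl | rfl⟩
    · rw [Finset.sum_eq_zero (fun i _ => if_neg (by omega)), sub_zero]
      have := congrArg (fun f => coeff f (2 * m)) hgodd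
      simp only [coeff_comp_neg_X', coeff_neg, (even_two_mul m).neg_one_pow, one_mul] at this
      have h3 : (2 : F) * g.coeff (2 * m) = 0 := by linear_combination this
      exact (mul_eq_zero.mp h3).resolve_left h2
    · rw [Finset.sum_eq_single (⟨m, by omega⟩ : Fin (N / 2))]
      · simp [hh]
      · intro i _ hi
        rw [if_neg]
        intro h3
        exact hi (Fin.ext (by simp; omega))
      · simp
  refine ⟨h, ?_⟩
  set H := Gh (N / 2) h
  have htot : X ^ N ∣ (b - b') - (b + b') * H := by
    have := dvd_add hgdvd (htr.mul_left (b + b'))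
    convert this using 1
    ring
  have htot' : X ^ d ∣ (b - b').comp (X ^ p) - (b + b').comp (X ^ p) * H.comp (X ^ p) := by
    obtain ⟨w, hw⟩ := htot
    have := congrArg (fun f => f.comp (X ^ p)) hw
    simp only [sub_comp, mul_comp, X_pow_comp] at this
    rw [← sub_comp, ← pow_mul] at this
    rw [this]
    exact (pow_dvd_pow X hN).mul_right _
  unfold InL
  have h9 := dvd_add (dvd_sub (dvd_sub hc hc') ((dvd_add hc hc').mul_right (H.comp (X ^ p))))
    (htot'.mul_left (a.comp (X ^ 2)))
  convert h9 using 1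
  simp only [sub_comp, add_comp]
  ring

lemma coeff_of_derivative {F : Type*} [Field F] (p : ℕ) [CharP F p] {c : F[X]}
    (hc : derivative c = 0) {n : ℕ} (hn : ¬ p ∣ n) : c.coeff n = 0 := by
  obtain _ | n := n
  · simp at hn
  have := congrArg (fun f => coeff f n) hc
  simp only [coeff_derivative, coeff_zero] at this
  refine (mul_eq_zero.mp this).resolve_right ?_
  intro h
  apply hn
  rw [← CharP.cast_eq_zero_iff F p]
  exact_mod_cast h

lemma card_pth {F : Type*} [Field F] [Fintype F] (p : ℕ) [CharP F p] (hp : 0 < p) (r : ℕ) :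
    (({c : F[X] | c.Monic ∧ c.natDegree = r ∧ derivative c = 0}.ncard : ℕ) : ℝ) ≤
      (Fintype.card F : ℝ) ^ ((r : ℝ) / p) := by
  set T := {c : F[X] | c.Monic ∧ c.natDegree = r ∧ derivative c = 0} with hT
  by_cases hr : p ∣ r
  · obtain ⟨m, rfl⟩ := hr
    have := Set.ncard_le_ncard_of_injOn (s := T) (t := (Set.univ : Set (Fin m → F)))
      (fun c j => c.coeff (p * j)) (fun _ _ => Set.mem_univ _) (by
        rintro c ⟨hc, hc1, hc2⟩ e ⟨he, he1, he2⟩ hce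
        ext n
        by_cases hn : p ∣ n
        · obtain ⟨j, rfl⟩ := hn
          rcases lt_trichotomy j m with h | h | h
          · exact congrFun hce ⟨j, h⟩
          · subst h
            have h1 := hc.coeff_natDegree
            have h2 := he.coeff_natDegree
            rw [hc1] at h1
            rw [he1] at h2
            rw [h1, h2]
          · have : p * m < p * j := Nat.mul_lt_mul_of_pos_left h hp
            rw [coeff_eq_zero_of_natDegree_lt (by omega), coeff_eq_zero_of_natDegree_lt (by omega)]
        · rw [coeff_of_derivative p hc2 hn, coeff_of_derivative p he2 hn]) Set.finite_univ
    have h3 : T.ncard ≤ Fintype.card F ^ m := by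
      simpa [Set.ncard_univ, Nat.card_eq_fintype_card] using this
    have h4 : ((p * m : ℕ) : ℝ) / p = (m : ℝ) := by
      push_cast
      field_simp
    rw [h4, Real.rpow_natCast]
    exact_mod_cast h3
  · have : T = ∅ := by
      rw [Set.eq_empty_iff_forall_notMem]
      rintro c ⟨hc, hc1, hc2⟩
      have h1 := hc.coeff_natDegree
      rw [hc1, coeff_of_derivative p hc2 hr] at h1
      exact zero_ne_one h1
    rw [this]
    simp
    positivity

lemma finite_natDegree {F : Type*} [Field F] [Fintype F] (r : ℕ) :
    {c : F[X] | c.natDegree = r}.Finite := by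
  have hinj : Set.InjOn (fun (c : F[X]) (j : Fin (r + 1)) => c.coeff j)
      {c : F[X] | c.natDegree = r} := by
    intro c hc e he hce
    simp only [Set.mem_ofPred_eq] at hc he
    ext n
    by_cases hn : n < r + 1
    · exact congrFun hce ⟨n, hn⟩
    · rw [coeff_eq_zero_of_natDegree_lt (by omega), coeff_eq_zero_of_natDegree_lt (by omega)]
  exact Set.Finite.of_finite_image (Set.toFinite _) hinj

lemma vM_ne_zero {F : Type*} [Field F] {c : F[X]} (h : vM c ≠ 0) :
    ∃ (P : F[X]) (k : ℕ), Irreducible P ∧ c = P ^ k := by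
  unfold vM at h
  rcases Set.eq_empty_or_nonempty {n : ℕ | ∃ (P : Polynomial F) (k : ℕ),
    P.Monic ∧ Irreducible P ∧ 1 ≤ k ∧ c = P ^ k ∧ n = P.natDegree} with h0 | ⟨n, P, k, -, hP, -, hc, -⟩
  · rw [h0] at h
    simp at h
  · exact ⟨P, k, hP, hc⟩

lemma even_of_comp_neg {F : Type*} [Field F] (h2 : (2 : F) ≠ 0) {c : F[X]}
    (h : c.comp (-X) = c) : ∃ a : F[X], c = a.comp (X ^ 2) := by
  refine ⟨contract 2 c, ?_⟩
  rw [← expand_eq_comp_X_pow]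
  ext n
  rw [coeff_expand (by norm_num)]
  split_ifs with hn
  · rw [coeff_contract (by norm_num), Nat.div_mul_cancel hn]
  · have := congrArg (fun f => coeff f n) h
    have ho : Odd n := by rw [← Nat.not_even_iff_odd]; rwa [even_iff_two_dvd]
    simp only [coeff_comp_neg_X', ho.neg_one_pow] at this
    have h3 : (2 : F) * c.coeff n = 0 := by linear_combination -this
    exact (mul_eq_zero.mp h3).resolve_left h2

lemma count_bound {F : Type*} [Field F] [Fintype F] (p : ℕ) [CharP F p] (hp : p.Prime)
    (hp2 : 2 < p) (d r : ℕ) (hd : Odd d) (hr : 1 ≤ r) (T : Set F[X])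
    (hT : ∀ c ∈ T, c.Monic ∧ c.natDegree = r ∧ c.comp (-X) ≠ c ∧
      (∃ (P : F[X]) (k : ℕ), Irreducible P ∧ c = P ^ k) ∧
      ∃ a b : F[X], a.eval 0 ≠ 0 ∧ b.eval 0 ≠ 0 ∧
        X ^ d ∣ c - a.comp (X ^ 2) * b.comp (X ^ p)) :
    (T.ncard : ℝ) ≤ (Fintype.card F : ℝ) ^ ((r : ℝ) - (1 - 1 / (p : ℝ)) * (d : ℝ) / 2 + 3) +
      (Fintype.card F : ℝ) ^ ((r : ℝ) / (p : ℝ)) := by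
  classical
  have hpodd : Odd p := hp.odd_of_ne_two (by omega)
  have hd1 : 1 ≤ d := hd.pos
  have h2 : (2 : F) ≠ 0 := by
    intro h
    have := (CharP.cast_eq_zero_iff F p 2).mp (by exact_mod_cast h)
    exact absurd (Nat.le_of_dvd (by norm_num) this) (by omega)
  have hq : (1 : ℝ) ≤ Fintype.card F := by exact_mod_cast Fintype.card_pos
  have hq0 : (0 : ℝ) < Fintype.card F := by linarith
  set N := d / p + 1 with hNd
  have hN : d ≤ p * N := by
    rw [hNd]
    exact (Nat.lt_mul_div_succ d hp.pos).le
  let G : (Fin (N / 2) → F) → F[X] := fun h => (Gh (N / 2) h).comp (X ^ p)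
  have hG : ∀ h, derivative (G h) = 0 := by
    intro h
    simp only [G, derivative_comp, derivative_X_pow, CharP.cast_eq_zero F p]
    simp
  let good : (Fin (N / 2) → F) → Prop := fun h =>
    ∀ c, c ≠ 0 → InL d (G h) c → d ≤ c.natDegree + r + 2
  let Th : (Fin (N / 2) → F) → Set F[X] := fun h => {c | c.natDegree = r ∧ InL d (G h) c ∧ good h}
  let Tp : Set F[X] := {c : F[X] | c.Monic ∧ c.natDegree = r ∧ derivative c = 0}
  have hsub : T ⊆ Tp ∪ ⋃ h ∈ (Finset.univ : Finset (Fin (N / 2) → F)), Th h := by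
    intro c hc
    obtain ⟨hm, hdeg, hne, ⟨P, k, hP, hPk⟩, a, b, ha, hb, hdvd⟩ := hT c hc
    obtain ⟨h, hh⟩ := exists_G h2 hpodd hN hb hdvd
    by_cases hgood : good h
    · right
      simp only [Set.mem_iUnion]
      exact ⟨h, Finset.mem_univ _, hdeg, hh, hgood⟩
    · left
      refine ⟨hm, hdeg, ?_⟩
      simp only [good, not_forall, not_le] at hgood
      obtain ⟨e, he, heL, hlt⟩ := hgood
      refine short_case h2 (hG h) hP hPk ?_ hne hh he heL (by omega)
      have h0 : (X : F[X]) ∣ c - a.comp (X ^ 2) * b.comp (X ^ p) :=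
        (dvd_pow_self X (by omega)).trans hdvd
      rw [X_dvd_iff, coeff_zero_eq_eval_zero] at h0
      simp only [eval_sub, eval_mul, eval_comp, eval_pow, eval_X] at h0
      rw [zero_pow (by norm_num), zero_pow hp.ne_zero] at h0
      rw [sub_eq_zero.mp h0]
      exact mul_ne_zero ha hb
  have hTh : ∀ h, ((Th h).ncard : ℝ) ≤ (Fintype.card F : ℝ) ^ ((r : ℝ) - d / 2 + 3 / 2) := by
    intro h
    by_cases hgood : good h
    · have : Th h = {c : F[X] | c.natDegree = r ∧ InL d (G h) c} := by
        ext c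
        simp [Th, hgood]
      rw [this]
      exact card_good_s13 h2 d r hd hr (G h) hgood
    · have : Th h = ∅ := by
        ext c
        simp [Th, hgood]
      rw [this]
      simp
      positivity
  have hfin : (Tp ∪ ⋃ h ∈ (Finset.univ : Finset (Fin (N / 2) → F)), Th h).Finite := by
    apply (finite_natDegree (F := F) r).subset
    rintro c (hc | hc)
    · exact hc.2.1
    · simp only [Set.mem_iUnion] at hc
      obtain ⟨h, -, hc⟩ := hc
      exact hc.1
  have h1 := Set.ncard_le_ncard hsub hfin
  have h3 := h1.trans (Set.ncard_union_le _ _)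
  have h4 := Finset.set_ncard_biUnion_le (Finset.univ : Finset (Fin (N / 2) → F)) Th
  have h5 : (T.ncard : ℝ) ≤ Tp.ncard + ∑ h, ((Th h).ncard : ℝ) := by
    exact_mod_cast h3.trans (Nat.add_le_add_left h4 _)
  have h6 : ∑ h, ((Th h).ncard : ℝ) ≤
      (Fintype.card F : ℝ) ^ ((r : ℝ) - (1 - 1 / (p : ℝ)) * (d : ℝ) / 2 + 3) := by
    calc ∑ h, ((Th h).ncard : ℝ)
        ≤ ∑ h : Fin (N / 2) → F, (Fintype.card F : ℝ) ^ ((r : ℝ) - d / 2 + 3 / 2) :=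
          Finset.sum_le_sum (fun h _ => hTh h)
      _ = (Fintype.card F : ℝ) ^ (((N / 2 : ℕ) : ℝ)) *
            (Fintype.card F : ℝ) ^ ((r : ℝ) - d / 2 + 3 / 2) := by
          rw [Finset.sum_const, Finset.card_univ, Fintype.card_fun, Fintype.card_fin,
            nsmul_eq_mul, Real.rpow_natCast]
          push_cast
          rfl
      _ = (Fintype.card F : ℝ) ^ (((N / 2 : ℕ) : ℝ) + ((r : ℝ) - d / 2 + 3 / 2)) := by
          exact (Real.rpow_add hq0 _ _).symm
      _ ≤ _ := by
          apply Real.rpow_le_rpow_of_exponent_le hq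
          have e1 : ((N / 2 : ℕ) : ℝ) ≤ (N : ℝ) / 2 := Nat.cast_div_le
          have e2 : ((d / p : ℕ) : ℝ) ≤ (d : ℝ) / p := Nat.cast_div_le
          have e3 : (N : ℝ) = ((d / p : ℕ) : ℝ) + 1 := by rw [hNd]; push_cast; rfl
          have e4 : (1 - 1 / (p : ℝ)) * (d : ℝ) / 2 = d / 2 - (d : ℝ) / p / 2 := by ring
          rw [e4]
          linarith
  have h7 := card_pth (F := F) p hp.pos r
  linarith

/-- There is an absolute constant `C > 0` such that for every prime `p > 2`, every finite
field `F_q` of characteristic `p`, every odd `d ≥ 1` coprime with `p`, and `Q = x^d` or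
`x^{d+1}`: letting `A` (resp. `B`) be the subgroup of residues mod `Q` of polynomials `u`
with `u(0) ≠ 0` congruent mod `Q` to a polynomial in `F_q[x²]` (resp. `F_q[x^p]`), one has
for every `r ≥ 1` the off-diagonal bound
`|ψ(r; AB) − ψ(r; A)| ≤ C·(r·q^{r−(1−1/p)d/2+3} + r·q^{r/p+3ω})`,
where `ω = 1` if `r > d/4 − 1` and `ω = 0` otherwise, and `ψ(r; N)` is the sum of `Λ(c)`
over monic `c` of degree `r` with `c mod Q ∈ N`. -/
theorem stmt_13 : ∃ C : ℝ, 0 < C ∧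
    ∀ (p : ℕ), p.Prime → 2 < p →
    ∀ (Fq : Type) [Field Fq] [Fintype Fq], CharP Fq p →
    ∀ (d : ℕ), 1 ≤ d → Odd d → Nat.Coprime d p →
    ∀ Q : Polynomial Fq, (Q = X ^ d ∨ Q = X ^ (d + 1)) →
    ∀ r : ℕ, 1 ≤ r →
      |((∑ᶠ c ∈ {c : Polynomial Fq | c.Monic ∧ c.natDegree = r ∧
            ∃ a b : Polynomial Fq, a.eval 0 ≠ 0 ∧ b.eval 0 ≠ 0 ∧
              Q ∣ c - a.comp (X ^ 2) * b.comp (X ^ p)}, vM c : ℕ) : ℝ) -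
        ((∑ᶠ c ∈ {c : Polynomial Fq | c.Monic ∧ c.natDegree = r ∧
            ∃ a : Polynomial Fq, a.eval 0 ≠ 0 ∧ Q ∣ c - a.comp (X ^ 2)}, vM c : ℕ) : ℝ)| ≤
        C * ((r : ℝ) * (Fintype.card Fq : ℝ) ^
            ((r : ℝ) - (1 - 1 / (p : ℝ)) * (d : ℝ) / 2 + 3) +
          (r : ℝ) * (Fintype.card Fq : ℝ) ^
            ((r : ℝ) / (p : ℝ) + 3 * (if (d : ℝ) / 4 - 1 < (r : ℝ) then (1 : ℝ) else 0))) := by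
  classical
  refine ⟨1, one_pos, ?_⟩
  intro p hp hp2 Fq _ _ hchar d hd1 hd hcop Q hQ r hr
  have hXQ : X ^ d ∣ Q := by
    rcases hQ with rfl | rfl
    · exact dvd_rfl
    · exact pow_dvd_pow X (Nat.le_succ d)
  have h2 : (2 : Fq) ≠ 0 := by
    intro h
    have := (CharP.cast_eq_zero_iff Fq p 2).mp (by exact_mod_cast h)
    exact absurd (Nat.le_of_dvd (by norm_num) this) (by omega)
  have hq : (1 : ℝ) ≤ Fintype.card Fq := by exact_mod_cast Fintype.card_pos
  set SAB := {c : Polynomial Fq | c.Monic ∧ c.natDegree = r ∧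
            ∃ a b : Polynomial Fq, a.eval 0 ≠ 0 ∧ b.eval 0 ≠ 0 ∧
              Q ∣ c - a.comp (X ^ 2) * b.comp (X ^ p)} with hSAB
  set SA := {c : Polynomial Fq | c.Monic ∧ c.natDegree = r ∧
            ∃ a : Polynomial Fq, a.eval 0 ≠ 0 ∧ Q ∣ c - a.comp (X ^ 2)} with hSA
  have hsub : SA ⊆ SAB := by
    rintro c ⟨hm, hdeg, a, ha, hdvd⟩
    exact ⟨hm, hdeg, a, 1, ha, by simp, by simpa using hdvd⟩
  have hfin : SAB.Finite := (finite_natDegree (F := Fq) r).subset (fun c hc => hc.2.1)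
  have hfinD : (SAB \ SA).Finite := hfin.subset Set.sdiff_subset
  have hsplit := finsum_mem_add_sdiff (f := fun c : Fq[X] => vM c) hsub hfin
  rw [← hsplit]
  push_cast
  rw [add_sub_cancel_left, abs_of_nonneg (Nat.cast_nonneg _), one_mul]
  set T : Finset Fq[X] := hfinD.toFinset.filter (fun c => vM c ≠ 0) with hTd
  have hsum : ∑ᶠ c ∈ SAB \ SA, vM c ≤ T.card * r := by
    rw [finsum_mem_eq_finite_toFinset_sum _ hfinD, ← Finset.sum_filter_ne_zero]
    rw [← smul_eq_mul]
    apply Finset.sum_le_card_nsmul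
    intro c hc
    rw [Finset.mem_filter, Set.Finite.mem_toFinset] at hc
    exact (vM_le c).trans hc.1.1.2.1.le
  have hcount := count_bound (F := Fq) p hp hp2 d r hd hr (T : Set Fq[X]) (by
    intro c hc
    rw [Finset.mem_coe, hTd, Finset.mem_filter, Set.Finite.mem_toFinset] at hc
    obtain ⟨⟨⟨hm, hdeg, a, b, ha, hb, hdvd⟩, hnA⟩, hv⟩ := hc
    refine ⟨hm, hdeg, ?_, vM_ne_zero hv, a, b, ha, hb, hXQ.trans hdvd⟩
    intro hev
    apply hnA
    obtain ⟨a', ha'⟩ := even_of_comp_neg h2 hev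
    refine ⟨hm, hdeg, a', ?_, by rw [← ha']; simp⟩
    have h0 : (X : Fq[X]) ∣ c - a.comp (X ^ 2) * b.comp (X ^ p) :=
      (dvd_pow_self X (by omega)).trans (hXQ.trans hdvd)
    rw [X_dvd_iff, coeff_zero_eq_eval_zero, ha'] at h0
    simp only [eval_sub, eval_mul, eval_comp, eval_pow, eval_X] at h0
    rw [zero_pow (by norm_num), zero_pow hp.ne_zero] at h0
    rw [sub_eq_zero.mp h0]
    exact mul_ne_zero ha hb)
  rw [Set.ncard_coe_finset] at hcount
  have hω : (Fintype.card Fq : ℝ) ^ ((r : ℝ) / (p : ℝ)) ≤ (Fintype.card Fq : ℝ) ^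
      ((r : ℝ) / (p : ℝ) + 3 * (if (d : ℝ) / 4 - 1 < (r : ℝ) then (1 : ℝ) else 0)) := by
    apply Real.rpow_le_rpow_of_exponent_le hq
    split_ifs <;> linarith
  have hsumR : ((∑ᶠ c ∈ SAB \ SA, vM c : ℕ) : ℝ) ≤ (T.card : ℝ) * r := by exact_mod_cast hsum
  refine hsumR.trans ?_
  rw [← mul_add, mul_comm]
  exact mul_le_mul_of_nonneg_left (hcount.trans (by linarith)) (Nat.cast_nonneg r)
end

section
/- There exists an absolute constant C > 0 with the following property. Let p > 2 be a prime, q a power of p, let d ≥ 1 be an odd integer coprime with p, and let Q denote either x^d or x^{d+1} in F_q[x]. Let A ⊆ (F_q[x]/Q)^× be the subgroup of residues of polynomials u with u(0) ≠ 0 that are congruent modulo Q to a polynomial in F_q[x^2]. Then for every integer r with 1 ≤ r < d(1 − 1/p), |ψ(r; A) − 1_{2|r}·q^{r/2}| ≤ C·q^{r/4}, where 1_{2|r} equals 1 if r is even and 0 if r is odd. -/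
open Polynomial

theorem aux_even_of_dvd {F : Type*} [Field F] {P : F[X]} (h0 : P.eval 0 ≠ 0)
    (h : P ∣ P.comp (-X)) : P.comp (-X) = P := by
  obtain ⟨u, hu⟩ := h
  have hP : P ≠ 0 := by rintro rfl; simp at h0
  have hu0 : u ≠ 0 := by
    rintro rfl
    have := congrArg (eval 0) hu
    simp at this
    exact h0 (by simpa using this)
  have hd : u.natDegree = 0 := by
    have := congrArg natDegree hu
    rw [natDegree_mul hP hu0, natDegree_comp] at this
    simp at this
    exact this
  obtain ⟨a, rfl⟩ := natDegree_eq_zero.mp hd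
  have h1 := congrArg (eval 0) hu
  rw [eval_comp, eval_mul, eval_C, eval_neg, eval_X, neg_zero] at h1
  have : a = 1 := mul_left_cancel₀ h0 (by rw [← h1, mul_one])
  rw [hu, this]; simp

theorem aux_coeff_odd {F : Type*} [Field F] (h2 : (2 : F) ≠ 0) {P : F[X]}
    (h : P.comp (-X) = P) {n : ℕ} (hn : Odd n) : P.coeff n = 0 := by
  have := congrArg (fun f => coeff f n) h
  have e : (-X : F[X]) = C (-1) * X := by simp
  simp only [e, comp_C_mul_X_coeff, hn.neg_one_pow] at this
  have h3 : 2 * P.coeff n = 0 := by linear_combination -this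
  exact (mul_eq_zero.mp h3).resolve_left h2

theorem aux_expand {F : Type*} [Field F] {P : F[X]}
    (h : ∀ n, Odd n → P.coeff n = 0) : P = expand F 2 (contract 2 P) := by
  ext n
  rw [coeff_expand two_pos, coeff_contract two_ne_zero]
  split_ifs with hd
  · rw [Nat.div_mul_cancel hd]
  · exact h n (Nat.not_even_iff_odd.mp (fun hh => hd hh.two_dvd))

theorem aux_expand_even {F : Type*} [Field F] (g : F[X]) :
    (expand F 2 g).comp (-X) = expand F 2 g := by
  rw [expand_eq_comp_X_pow, comp_assoc]; simp

theorem aux_qodd {F : Type*} [Field F] [Finite F] (h2 : (2 : F) ≠ 0) : Odd (Nat.card F) := by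
  have := Fintype.ofFinite F
  rw [Nat.card_eq_fintype_card]
  have := FiniteField.odd_card_of_char_ne_two (F := F) (by
    intro h
    apply h2
    have := CharP.cast_eq_zero F (ringChar F)
    rw [h] at this; exact_mod_cast this)
  exact Nat.odd_iff.mpr this

theorem aux_key {F : Type*} [Field F] [Finite F] (h2 : (2 : F) ≠ 0) {P : F[X]}
    (hi : Irreducible P) (he : P.comp (-X) = P) :
    ∃ j, P.natDegree = 2 * j ∧ P ∣ X ^ (Nat.card F ^ j) + X := by
  have hP := aux_expand (fun n hn => aux_coeff_odd h2 he hn)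
  set h := contract 2 P with hh
  have hhi : Irreducible h := by
    rw [hP] at hi
    exact Polynomial.of_irreducible_expand two_ne_zero hi
  refine ⟨h.natDegree, by conv_lhs => rw [hP, natDegree_expand, mul_comm], ?_⟩
  have h1 : h ∣ X ^ (Nat.card F ^ h.natDegree) - X :=
    hhi.natDegree_dvd_iff_dvd_X_pow_card_pow_sub_X.mp dvd_rfl
  have h3 : P ∣ (X ^ (Nat.card F ^ h.natDegree) - X) * (X ^ (Nat.card F ^ h.natDegree) + X) := by
    have := map_dvd (expand F 2) h1
    rw [← hP] at this
    convert this using 1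
    simp
    ring
  rcases hi.prime.dvd_or_dvd h3 with h4 | h4
  · exfalso
    have := hi.natDegree_dvd_of_dvd_X_pow_card_pow_sub_X h4
    rw [hP, natDegree_expand] at this
    have := Nat.le_of_dvd hhi.natDegree_pos this
    have := hhi.natDegree_pos
    omega
  · exact h4

theorem aux_iter {F : Type*} [Field F] [Finite F] (h2 : (2 : F) ≠ 0) {P : F[X]} {j : ℕ}
    (h : P ∣ X ^ (Nat.card F ^ j) + X) (n : ℕ) :
    P ∣ X ^ (Nat.card F ^ (j * n)) - (-1) ^ n * X := by
  have hq := aux_qodd h2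
  set q := Nat.card F
  have hy : (AdjoinRoot.root P) ^ (q ^ j) = - AdjoinRoot.root P := by
    have := AdjoinRoot.mk_eq_zero.mpr h
    simp at this
    exact eq_neg_of_add_eq_zero_left this
  rw [← AdjoinRoot.mk_eq_zero]
  simp
  rw [sub_eq_zero]
  induction n with
  | zero => simp
  | succ n ih =>
    rw [Nat.mul_succ, pow_add, pow_mul, ih, mul_pow, hy, ← pow_mul, mul_comm n, pow_mul,
      (hq.pow).neg_one_pow]
    ring

theorem aux_conv {F : Type*} [Field F] [Finite F] (h2 : (2 : F) ≠ 0) {P : F[X]}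
    (hi : Irreducible P) {m : ℕ} (h : P ∣ X ^ (Nat.card F ^ m) + X) (h0 : P.eval 0 ≠ 0) :
    P.comp (-X) = P ∧ P.natDegree ∣ 2 * m := by
  constructor
  · apply aux_even_of_dvd h0
    have hy : (AdjoinRoot.root P) ^ (Nat.card F ^ m) = - AdjoinRoot.root P := by
      have := AdjoinRoot.mk_eq_zero.mpr h
      simp at this
      exact eq_neg_of_add_eq_zero_left this
    have := Fintype.ofFinite F
    have h1 : ∀ (m : ℕ) (y : AdjoinRoot P),
        aeval (y ^ (Nat.card F ^ m)) P = (aeval y P) ^ (Nat.card F ^ m) := by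
      intro m
      induction m with
      | zero => simp
      | succ m ih =>
        intro y
        rw [pow_succ, pow_mul, ← expand_aeval, Nat.card_eq_fintype_card, FiniteField.expand_card,
          map_pow, ← Nat.card_eq_fintype_card, ih, pow_mul]
    have h3 := h1 m (AdjoinRoot.root P)
    rw [hy, AdjoinRoot.aeval_eq, AdjoinRoot.mk_self, zero_pow (pow_ne_zero _ Nat.card_pos.ne')] at h3
    rw [← AdjoinRoot.mk_eq_zero, ← AdjoinRoot.aeval_eq, aeval_comp]
    simpa using h3
  · apply hi.natDegree_dvd_of_dvd_X_pow_card_pow_sub_X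
    have := aux_iter h2 h 2
    rw [mul_comm] at this
    simpa using this

open UniqueFactorizationMonoid in
theorem aux_sum_le {F : Type*} [Field F] (f : F[X]) (hf : f ≠ 0) (S : Finset F[X])
    (hS : ∀ P ∈ S, P.Monic ∧ Irreducible P ∧ P ∣ f) : ∑ P ∈ S, P.natDegree ≤ f.natDegree := by
  rw [← natDegree_prod_of_monic _ _ (fun P hP => (hS P hP).1)]
  apply natDegree_le_of_dvd _ hf
  apply Finset.prod_dvd_of_coprime
  · intro P hP R hR hne
    refine (hS P hP).2.1.coprime_iff_not_dvd.mpr (fun hd => hne ?_)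
    exact eq_of_monic_of_associated (hS P hP).1 (hS R hR).1
      ((hS P hP).2.1.associated_of_dvd (hS R hR).2.1 hd)
  · intro P hP; exact (hS P hP).2.2

open UniqueFactorizationMonoid in
theorem aux_sum_eq {F : Type*} [Field F] (f : F[X]) (hf : f.Monic) (hs : Squarefree f)
    (S : Finset F[X])
    (hS : ∀ P, P ∈ S ↔ P.Monic ∧ Irreducible P ∧ P ∣ f) : ∑ P ∈ S, P.natDegree = f.natDegree := by
  classical
  have e : S = (normalizedFactors f).toFinset := by
    ext P
    rw [hS, Multiset.mem_toFinset, Polynomial.mem_normalizedFactors_iff hf.ne_zero]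
    tauto
  have hn := (squarefree_iff_nodup_normalizedFactors hf.ne_zero).mp hs
  rw [← natDegree_prod_of_monic _ _ (fun P hP => ((hS P).mp hP).1), e]
  have := leadingCoeff_mul_prod_normalizedFactors f
  rw [hf.leadingCoeff] at this
  simp at this
  have h3 : ∏ P ∈ (normalizedFactors f).toFinset, P = (normalizedFactors f).prod := by
    rw [Finset.prod_eq_multiset_prod, Multiset.toFinset_val, Multiset.dedup_eq_self.mpr hn,
      Multiset.map_id']
  rw [h3, this]

theorem aux_vM {F : Type*} [Field F] {P : F[X]} (hm : P.Monic) (hi : Irreducible P) {k : ℕ}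
    (hk : 1 ≤ k) : vM (P ^ k) = P.natDegree := by
  unfold vM
  refine Eq.trans (congrArg sSup ?_) (csSup_singleton P.natDegree)
  ext n
  constructor
  · rintro ⟨R, l, hR, hRi, hl, e, rfl⟩
    have h1 : P ∣ R := hi.prime.dvd_of_dvd_pow (e ▸ dvd_pow_self P (by omega))
    have h3 := eq_of_monic_of_associated hm hR (hi.associated_of_dvd hRi h1)
    simp [h3]
  · rintro rfl
    exact ⟨P, k, hm, hi, hk, rfl, rfl⟩

theorem aux_vM_ne {F : Type*} [Field F] {c : F[X]} (h : vM c ≠ 0) :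
    ∃ (P : F[X]) (k : ℕ), P.Monic ∧ Irreducible P ∧ 1 ≤ k ∧ c = P ^ k := by
  by_contra hh
  push Not at hh
  apply h
  unfold vM
  refine Eq.trans (congrArg sSup (?_ : _ = (∅ : Set ℕ))) (by simp)
  ext n
  simp
  intro P hP hPi k hk e
  exact absurd e (hh P k hP hPi hk)

theorem aux_dvd_X {F : Type*} [Field F] {P : F[X]} (hi : Irreducible P) (h0 : P.eval 0 ≠ 0) :
    ¬ P ∣ X := by
  intro h
  have := (hi.associated_of_dvd irreducible_X h).symm.dvd
  exact h0 (by rw [← coeff_zero_eq_eval_zero]; exact X_dvd_iff.mp this)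

theorem aux_bound {F : Type*} [Field F] [Finite F] (h2 : (2 : F) ≠ 0) {m : ℕ} (hm : 1 ≤ m)
    (S : Finset F[X]) (hS : ∀ P, P ∈ S ↔ P.Monic ∧ Irreducible P ∧ P.natDegree ∣ 2 * m ∧
      P.comp (-X) = P ∧ P.eval 0 ≠ 0) :
    Nat.card F ^ m ≤ ∑ P ∈ S, P.natDegree + 1 ∧
    ∑ P ∈ S, P.natDegree + 1 ≤ Nat.card F ^ m + 2 * Nat.card F ^ (m / 2) := by
  classical
  have hq1 : 1 < Nat.card F := Finite.one_lt_card
  have hqm : 1 < Nat.card F ^ m := Nat.one_lt_pow (by omega) hq1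
  set f : F[X] := X ^ (Nat.card F ^ m - 1) - C (-1) with hf
  have hXf : X * f = X ^ (Nat.card F ^ m) + X := by
    have : Nat.card F ^ m = (Nat.card F ^ m - 1) + 1 := by omega
    rw [hf]; conv_rhs => rw [this]
    simp; ring
  have hfm : f.Monic := monic_X_pow_sub_C _ (by omega)
  have hfd : f.natDegree = Nat.card F ^ m - 1 := natDegree_X_pow_sub_C
  have hfs : Squarefree f := by
    apply Separable.squarefree
    apply separable_X_pow_sub_C
    · rw [Nat.cast_sub hqm.le, Nat.cast_pow]
      have : Fintype F := Fintype.ofFinite F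
      rw [Nat.card_eq_fintype_card, FiniteField.cast_card_eq_zero, zero_pow (by omega)]
      simp
    · simp
  have hf0 : f.eval 0 = 1 := by
    simp [hf, zero_pow (show Nat.card F ^ m - 1 ≠ 0 by omega)]
  have e1 : ∑ P ∈ S.filter (fun P => P ∣ f), P.natDegree = Nat.card F ^ m - 1 := by
    rw [← hfd]
    apply aux_sum_eq f hfm hfs
    intro P
    rw [Finset.mem_filter, hS]
    constructor
    · rintro ⟨⟨h1, h2, -⟩, h3⟩; exact ⟨h1, h2, h3⟩
    · rintro ⟨h1, h3, h4⟩
      have h5 : P.eval 0 ≠ 0 := by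
        intro h
        have := eval_dvd (x := 0) h4
        rw [hf0, h] at this
        simp at this
      have h6 := aux_conv h2 h3 (m := m) (hXf ▸ h4.mul_left X) h5
      exact ⟨⟨h1, h3, h6.2, h6.1, h5⟩, h4⟩
  have e2 : ∑ P ∈ S.filter (fun P => ¬ P ∣ f), P.natDegree ≤ 2 * Nat.card F ^ (m / 2) := by
    by_cases hm2 : m = 1
    · subst hm2
      rw [Finset.sum_eq_zero]
      · simp
      intro P hP
      exfalso
      rw [Finset.mem_filter, hS] at hP
      obtain ⟨⟨h1, h3, ⟨k, hk⟩, h5, h6⟩, h7⟩ := hP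
      obtain ⟨j, hj, hd⟩ := aux_key h2 h3 h5
      have : j * k = 1 := by rw [hj] at hk; nlinarith
      have hj1 : j = 1 := Nat.eq_one_of_mul_eq_one_right this
      rw [hj1, ← hXf] at hd
      exact h7 ((h3.prime.dvd_or_dvd hd).resolve_left (aux_dvd_X h3 h6))
    have hQ : 1 < Nat.card F ^ (m / 2) := Nat.one_lt_pow (by omega) hq1
    set Q := Nat.card F ^ (m / 2) with hQd
    have hg : ((X ^ Q) ^ 2 - X ^ 2 : F[X]).natDegree = 2 * Q := by
      rw [natDegree_sub_eq_left_of_natDegree_lt] <;> simp <;> omega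
    rw [← hg]
    apply aux_sum_le
    · intro h; rw [h] at hg; simp at hg; omega
    intro P hP
    rw [Finset.mem_filter, hS] at hP
    obtain ⟨⟨h1, h3, ⟨k, hk⟩, h5, h6⟩, h7⟩ := hP
    refine ⟨h1, h3, ?_⟩
    obtain ⟨j, hj, hd⟩ := aux_key h2 h3 h5
    have hjk : m = j * k := by rw [hj] at hk; nlinarith
    rcases Nat.even_or_odd k with ⟨l, hl⟩ | hko
    · have hml : m / 2 = j * l := by
        have : m = 2 * (j * l) := by rw [hjk, hl]; ring
        omega
      have := aux_iter h2 hd l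
      rw [← hml, ← hQd] at this
      have h8 : ((X ^ Q) ^ 2 - X ^ 2 : F[X]) = (X ^ Q - (-1) ^ l * X) * (X ^ Q + (-1) ^ l * X) := by
        have : ((-1 : F[X]) ^ l) ^ 2 = 1 := by rw [← pow_mul, mul_comm, pow_mul]; simp
        linear_combination (X ^ 2) * this
      rw [h8]
      exact this.mul_right _
    · exfalso
      have := aux_iter h2 hd k
      rw [← hjk, hko.neg_one_pow, neg_one_mul, sub_neg_eq_add, ← hXf] at this
      exact h7 ((h3.prime.dvd_or_dvd this).resolve_left (aux_dvd_X h3 h6))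
  have e3 := Finset.sum_filter_add_sum_filter_not S (fun P => P ∣ f) (fun P => P.natDegree)
  omega

open UniqueFactorizationMonoid in
theorem aux_main {F : Type*} [Field F] [Finite F] (h2 : (2 : F) ≠ 0) {m : ℕ} (hm : 1 ≤ m)
    (A : Set F[X]) (hA : ∀ c, c ∈ A ↔ c.Monic ∧ c.natDegree = 2 * m ∧
      c.comp (-X) = c ∧ c.eval 0 ≠ 0) :
    Nat.card F ^ m ≤ ∑ᶠ c ∈ A, vM c + 1 ∧
    ∑ᶠ c ∈ A, vM c + 1 ≤ Nat.card F ^ m + 2 * Nat.card F ^ (m / 2) := by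
  classical
  have hq1 : 1 < Nat.card F := Finite.one_lt_card
  set S : Finset F[X] := (normalizedFactors (X ^ (Nat.card F ^ (2 * m)) - X : F[X])).toFinset.filter
    (fun P => P.comp (-X) = P ∧ P.eval 0 ≠ 0) with hSd
  have hS : ∀ P, P ∈ S ↔ P.Monic ∧ Irreducible P ∧ P.natDegree ∣ 2 * m ∧
      P.comp (-X) = P ∧ P.eval 0 ≠ 0 := by
    intro P
    rw [hSd, Finset.mem_filter, Multiset.mem_toFinset, Polynomial.mem_normalizedFactors_iff
      (FiniteField.X_pow_card_pow_sub_X_ne_zero _ (by omega) hq1)]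
    constructor
    · rintro ⟨⟨h1, h3, h4⟩, h5⟩
      exact ⟨h3, h1, h1.natDegree_dvd_iff_dvd_X_pow_card_pow_sub_X.mpr h4, h5⟩
    · rintro ⟨h3, h1, h4, h5⟩
      exact ⟨⟨h1, h3, h1.natDegree_dvd_iff_dvd_X_pow_card_pow_sub_X.mp h4⟩, h5⟩
  have key : ∑ᶠ c ∈ A, vM c = ∑ P ∈ S, P.natDegree := by
    rw [← finsum_mem_inter_support, ← finsum_mem_coe_finset]
    symm
    have hpos : ∀ P ∈ S, 1 ≤ 2 * m / P.natDegree := by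
      intro P hP
      have h := (hS P).mp hP
      exact Nat.div_pos (Nat.le_of_dvd (by omega) h.2.2.1) h.2.1.natDegree_pos
    apply finsum_mem_eq_of_bijOn (fun P => P ^ (2 * m / P.natDegree))
    · refine ⟨?_, ?_, ?_⟩
      · intro P hP
        have h := (hS P).mp hP
        refine ⟨(hA _).mpr ⟨h.1.pow _, ?_, ?_, ?_⟩, ?_⟩
        · rw [natDegree_pow, Nat.div_mul_cancel h.2.2.1]
        · simp only [pow_comp, h.2.2.2.1]
        · rw [eval_pow]; exact pow_ne_zero _ h.2.2.2.2
        · rw [Function.mem_support, aux_vM h.1 h.2.1 (hpos P hP)]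
          exact h.2.1.natDegree_pos.ne'
      · intro P hP R hR e
        have h := (hS P).mp hP
        have h' := (hS R).mp hR
        have hd : P ∣ R := h.2.1.prime.dvd_of_dvd_pow
          ((dvd_pow_self P (by have := hpos P hP; omega)).trans (dvd_of_eq e))
        exact eq_of_monic_of_associated h.1 h'.1 (h.2.1.associated_of_dvd h'.2.1 hd)
      · rintro c ⟨hc, hc0⟩
        obtain ⟨P, k, hPm, hPi, hk, rfl⟩ := aux_vM_ne hc0
        obtain ⟨-, hdeg, hev, h0⟩ := (hA _).mp hc
        rw [natDegree_pow] at hdeg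
        rw [eval_pow] at h0
        have hP0 : P.eval 0 ≠ 0 := fun h => h0 (by rw [h, zero_pow (by omega)])
        have hPe : P.comp (-X) = P := by
          apply aux_even_of_dvd hP0
          apply hPi.prime.dvd_of_dvd_pow (n := k)
          rw [← pow_comp, hev]
          exact dvd_pow_self P (by omega)
        refine ⟨P, (hS P).mpr ⟨hPm, hPi, ⟨k, by rw [← hdeg, mul_comm]⟩, hPe, hP0⟩, ?_⟩
        show P ^ (2 * m / P.natDegree) = P ^ k
        rw [← hdeg, Nat.mul_div_cancel _ hPi.natDegree_pos]
    · intro P hP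
      have h := (hS P).mp hP
      exact (aux_vM h.1 h.2.1 (hpos P hP)).symm
  rw [key]
  exact aux_bound h2 hm S hS

theorem aux_coeff_of_dvd {F : Type*} [Field F] {c a Q : F[X]} {d : ℕ}
    (hQ : X ^ d ∣ Q) (hc : c.natDegree < d) (h : Q ∣ c - a.comp (X ^ 2)) :
    ∀ n, Odd n → c.coeff n = 0 := by
  intro n hn
  by_cases hnd : n < d
  · have := X_pow_dvd_iff.mp (hQ.trans h) n hnd
    rw [coeff_sub, ← expand_eq_comp_X_pow, coeff_expand two_pos, if_neg, sub_zero] at this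
    · exact this
    · exact fun h => (Nat.not_even_iff_odd.mpr hn) (even_iff_two_dvd.mpr h)
  · exact coeff_eq_zero_of_natDegree_lt (by omega)

/-- There is an absolute constant `C > 0` such that for every prime `p > 2`, every finite
field `F_q` of characteristic `p`, every odd `d ≥ 1` coprime with `p`, `Q = x^d` or
`x^{d+1}`, and every `1 ≤ r < d(1 − 1/p)`: letting `A` be the subgroup of residues mod `Q`
of polynomials `u` with `u(0) ≠ 0` congruent mod `Q` to a polynomial in `F_q[x²]`, one has
`|ψ(r; A) − 1_{2∣r}·q^{r/2}| ≤ C·q^{r/4}`, where `ψ(r; N)` is the sum of `Λ(c)` over monic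
`c` of degree `r` with `c mod Q ∈ N`. -/
theorem stmt_14 : ∃ C : ℝ, 0 < C ∧
    ∀ (p : ℕ), p.Prime → 2 < p →
    ∀ (Fq : Type) [Field Fq] [Fintype Fq], CharP Fq p →
    ∀ (d : ℕ), 1 ≤ d → Odd d → Nat.Coprime d p →
    ∀ Q : Polynomial Fq, (Q = X ^ d ∨ Q = X ^ (d + 1)) →
    ∀ r : ℕ, 1 ≤ r → (r : ℝ) < (d : ℝ) * (1 - 1 / (p : ℝ)) →
      |((∑ᶠ c ∈ {c : Polynomial Fq | c.Monic ∧ c.natDegree = r ∧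
            ∃ a : Polynomial Fq, a.eval 0 ≠ 0 ∧ Q ∣ c - a.comp (X ^ 2)}, vM c : ℕ) : ℝ) -
          (if 2 ∣ r then (1 : ℝ) else 0) * (Fintype.card Fq : ℝ) ^ ((r : ℝ) / 2)| ≤
        C * (Fintype.card Fq : ℝ) ^ ((r : ℝ) / 4) := by
  refine ⟨3, by norm_num, ?_⟩
  intro p hp hp2 Fq _ _ hchar d hd hdo hdp Q hQ r hr hrd
  have h2 : (2 : Fq) ≠ 0 := by
    intro h
    have h3 : ((2 : ℕ) : Fq) = 0 := by exact_mod_cast h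
    have := Nat.le_of_dvd (by norm_num) ((CharP.cast_eq_zero_iff Fq p 2).mp h3)
    omega
  have hrd' : r < d := by
    have h1 : (0 : ℝ) ≤ 1 / (p : ℝ) := by positivity
    have h3 : (0 : ℝ) ≤ (d : ℝ) := by positivity
    have : (r : ℝ) < d := by nlinarith
    exact_mod_cast this
  have hXQ : X ^ d ∣ Q := by
    rcases hQ with rfl | rfl
    · exact dvd_rfl
    · exact pow_dvd_pow _ (by omega)
  have hq1 : (1 : ℝ) ≤ (Fintype.card Fq : ℝ) := by
    exact_mod_cast Fintype.card_pos
  set A : Set (Polynomial Fq) := {c : Polynomial Fq | c.Monic ∧ c.natDegree = r ∧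
            ∃ a : Polynomial Fq, a.eval 0 ≠ 0 ∧ Q ∣ c - a.comp (X ^ 2)} with hA
  by_cases hr2 : 2 ∣ r
  · obtain ⟨m, rfl⟩ := hr2
    have hmem : ∀ c, c ∈ A ↔ c.Monic ∧ c.natDegree = 2 * m ∧
        c.comp (-X) = c ∧ c.eval 0 ≠ 0 := by
      intro c
      constructor
      · rintro ⟨h1, h3, a, h4, h5⟩
        have h6 := aux_expand (aux_coeff_of_dvd hXQ (by omega) h5)
        refine ⟨h1, h3, ?_, ?_⟩
        · rw [h6]; exact aux_expand_even _
        · have := X_pow_dvd_iff.mp (hXQ.trans h5) 0 (by omega)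
          rw [coeff_zero_eq_eval_zero, eval_sub, eval_comp] at this
          simp only [eval_pow, eval_X] at this
          rw [zero_pow two_ne_zero, sub_eq_zero] at this
          rw [this]; exact h4
      · rintro ⟨h1, h3, h4, h5⟩
        have h6 := aux_expand (fun n hn => aux_coeff_odd h2 h4 hn)
        refine ⟨h1, h3, contract 2 c, ?_, ?_⟩
        · intro h; apply h5
          rw [h6, expand_eval, zero_pow two_ne_zero, h]
        · rw [← expand_eq_comp_X_pow, ← h6, sub_self]; exact dvd_zero _
    obtain ⟨b1, b2⟩ := aux_main h2 (by omega) A hmem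
    set T := ∑ᶠ c ∈ A, vM c
    rw [Nat.card_eq_fintype_card] at b1 b2
    set q := Fintype.card Fq
    have b1' : (q : ℝ) ^ m ≤ T + 1 := by exact_mod_cast b1
    have b2' : (T : ℝ) + 1 ≤ (q : ℝ) ^ m + 2 * (q : ℝ) ^ (m / 2) := by exact_mod_cast b2
    have e1 : (q : ℝ) ^ (((2 * m : ℕ) : ℝ) / 2) = (q : ℝ) ^ m := by
      rw [← Real.rpow_natCast]; congr 1; push_cast; ring
    have e2 : (q : ℝ) ^ (m / 2) ≤ (q : ℝ) ^ (((2 * m : ℕ) : ℝ) / 4) := by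
      rw [← Real.rpow_natCast]
      apply Real.rpow_le_rpow_of_exponent_le hq1
      have : ((m / 2 : ℕ) : ℝ) ≤ (m : ℝ) / 2 := Nat.cast_div_le
      push_cast
      linarith
    have e3 : (1 : ℝ) ≤ (q : ℝ) ^ (m / 2) := one_le_pow₀ hq1
    rw [if_pos (dvd_mul_right 2 m), e1, abs_le]
    constructor <;> linarith
  · have hempty : A = ∅ := by
      rw [Set.eq_empty_iff_forall_notMem]
      rintro c ⟨h1, h3, a, -, h5⟩
      have := aux_coeff_of_dvd hXQ (by omega) h5 r
        (Nat.not_even_iff_odd.mp (fun h => hr2 h.two_dvd))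
      rw [← h3, coeff_natDegree, h1.leadingCoeff] at this
      exact one_ne_zero this
    rw [hempty, finsum_mem_empty, if_neg hr2]
    simp only [Nat.cast_zero, zero_mul, sub_zero, abs_zero]
    positivity
end
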